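/- arXiv:1502.00150 — 3 statements merged into one kernel-verified Lean document; each statement's English description precedes it below -/
import Mathlib

section
/- Let (c_n)_{n∈ℤ} be a bounded cosine sequence in a unital Banach algebra A such that the spectrum of c_1 is a singleton. Then there exists b ∈ ℝ such that c_n = cos(nb)·1_A for all n ≥ 1. -/
open Polynomial in
/-- If a cosine sequence starts with `c 1 = z + q`, `q ^ 2 = 0`, then it is the first order Taylor
expansion of the Chebyshev polynomials at `z`. -/
theorem cosine_eq_of_mul_self_eq_zero {A : Type*} [Ring A] [Algebra ℂ A] {c : ℕ → A}
    (h0 : c 0 = 1) (hrec : ∀ n, c (n + 2) = 2 * c 1 * c (n + 1) - c n) {z : ℂ} {q : A}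
    (h1 : c 1 = algebraMap ℂ A z + q) (hq : q * q = 0) (n : ℕ) :
    c n = ((Chebyshev.T ℂ n).eval z) • (1 : A) +
      ((derivative (Chebyshev.T ℂ n)).eval z) • q := by
  induction n using Nat.twoStepInduction with
  | zero => simp [h0]
  | one => simp [h1, Algebra.algebraMap_eq_smul_one]
  | more n ih1 ih2 =>
    rw [hrec, ih1, ih2, h1, Algebra.algebraMap_eq_smul_one]
    push_cast
    rw [Chebyshev.T_add_two]
    simp only [derivative_sub, derivative_mul, derivative_X, derivative_ofNat, eval_sub, eval_add,
      eval_mul, eval_ofNat, eval_X, zero_mul, zero_add, mul_one]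
    simp only [two_mul (_ • (1 : A) + q), add_mul, mul_add, smul_mul_assoc, mul_smul_comm, one_mul,
      mul_one, hq]
    module

open Polynomial in
/-- The derivatives of the Chebyshev polynomials at a point of `[-1, 1]` are unbounded. -/
theorem not_bounded_derivative_chebyshevT {z : ℂ} (hz : ‖z‖ ≤ 1) (C : ℝ)
    (hC : ∀ n : ℕ, ‖(derivative (Chebyshev.T ℂ n)).eval z‖ ≤ C) : False := by
  have hU (n : ℤ) : (Chebyshev.U ℂ n).eval z = (Chebyshev.S ℂ n).eval (2 * z) := by
    rw [← Chebyshev.S_comp_two_mul_X]; simp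
  have hid (n : ℤ) : (Chebyshev.U ℂ n).eval z ^ 2 + (Chebyshev.U ℂ (n + 1)).eval z ^ 2 -
      2 * z * (Chebyshev.U ℂ n).eval z * (Chebyshev.U ℂ (n + 1)).eval z = 1 := by
    simpa [hU] using congrArg (eval (2 * z)) (Chebyshev.S_sq_add_S_sq ℂ n)
  have hC0 : 0 ≤ C := (norm_nonneg _).trans (hC 0)
  obtain ⟨N, hN⟩ := exists_nat_gt (2 * C)
  have hb (n : ℕ) (hn : N ≤ n) (hn0 : 0 < n) : ‖(Chebyshev.U ℂ (n - 1)).eval z‖ < 1 / 2 := by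
    have h := hC n
    rw [Chebyshev.T_derivative_eq_U, eval_mul, norm_mul] at h
    simp only [Int.cast_natCast, eval_natCast, Complex.norm_natCast] at h
    have hn' : (N : ℝ) ≤ n := by exact_mod_cast hn
    have : (0 : ℝ) < n := by exact_mod_cast hn0
    by_contra! h'
    nlinarith
  have ha := hb (N + 1) (by omega) (by omega)
  have hb' := hb (N + 2) (by omega) (by omega)
  have h := hid N
  rw [show (((N + 1 : ℕ) : ℤ) - 1) = N by push_cast; ring] at ha
  rw [show (((N + 2 : ℕ) : ℤ) - 1) = N + 1 by push_cast; ring] at hb'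
  generalize (Chebyshev.U ℂ N).eval z = a at *
  generalize (Chebyshev.U ℂ (N + 1)).eval z = b at *
  have h1 : (1 : ℝ) ≤ ‖a‖ ^ 2 + ‖b‖ ^ 2 + 2 * ‖z‖ * ‖a‖ * ‖b‖ := by
    calc (1 : ℝ) = ‖a ^ 2 + b ^ 2 - 2 * z * a * b‖ := by rw [h]; simp
      _ ≤ ‖a ^ 2‖ + ‖b ^ 2‖ + ‖2 * z * a * b‖ :=
        (norm_sub_le _ _).trans (by gcongr; exact norm_add_le _ _)
      _ = _ := by simp
  have h2 : 2 * ‖z‖ * ‖a‖ * ‖b‖ ≤ 2 * 1 * ‖a‖ * ‖b‖ := by gcongr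
  nlinarith [norm_nonneg a, norm_nonneg b]

/-- The Joukowski map covers the plane from the closed unit disc. -/
theorem exists_norm_le_one_sq_add_one (l : ℂ) :
    ∃ t : ℂ, ‖t‖ ≤ 1 ∧ t ^ 2 + 1 = 2 * l * t := by
  obtain ⟨s, hs⟩ := IsAlgClosed.exists_pow_nat_eq (l ^ 2 - 1) (n := 2) (by norm_num)
  by_cases h : ‖l + s‖ ≤ 1
  · exact ⟨l + s, h, by linear_combination hs⟩
  · refine ⟨l - s, ?_, by linear_combination hs⟩
    have h1 : ‖l + s‖ * ‖l - s‖ = 1 := by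
      rw [← norm_mul, show (l + s) * (l - s) = 1 by linear_combination -hs, norm_one]
    push Not at h
    nlinarith [norm_nonneg (l - s)]

theorem eq_ofReal_of_sq_add_one {l t : ℂ} (ht : ‖t‖ = 1) (h : t ^ 2 + 1 = 2 * l * t) :
    l = (t.re : ℂ) := by
  have ht0 : t ≠ 0 := by rintro rfl; simp at ht
  have h1 : t * (starRingEnd ℂ) t = 1 := by
    rw [Complex.mul_conj, Complex.normSq_eq_norm_sq, ht]; simp
  have h2 : t + (starRingEnd ℂ) t = 2 * (t.re : ℂ) := by
    rw [Complex.add_conj]; push_cast; ring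
  apply mul_left_cancel₀ (mul_ne_zero two_ne_zero ht0)
  linear_combination -h - h1 + t * h2

theorem norm_mul_abs_im_le {l t : ℂ} (ht : ‖t‖ ≤ 1) (h : t ^ 2 + 1 = 2 * l * t) :
    ‖t‖ * |l.im| ≤ 1 - ‖t‖ := by
  have ht0 : t ≠ 0 := by rintro rfl; simp at h
  have hpos : 0 < ‖t‖ := norm_pos_iff.2 ht0
  have h1 : t * (starRingEnd ℂ) t = (‖t‖ : ℂ) ^ 2 := by
    rw [Complex.mul_conj, Complex.normSq_eq_norm_sq]; simp
  have h2 : 2 * l * (‖t‖ : ℂ) ^ 2 = t * (‖t‖ : ℂ) ^ 2 + (starRingEnd ℂ) t := by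
    linear_combination (t - 2 * l) * h1 - (starRingEnd ℂ) t * h
  have h3 : 2 * l.im * ‖t‖ ^ 2 = t.im * (‖t‖ ^ 2 - 1) := by
    have := congrArg Complex.im h2
    rw [← Complex.ofReal_pow] at this
    simp [-Complex.ofReal_pow] at this
    linear_combination this
  have h4 : 2 * |l.im| * ‖t‖ ^ 2 = |t.im| * (1 - ‖t‖ ^ 2) := by
    have := congrArg abs h3
    rw [abs_mul, abs_mul, abs_mul, abs_two, abs_of_nonneg (sq_nonneg ‖t‖),
      abs_of_nonpos (a := ‖t‖ ^ 2 - 1) (by nlinarith)] at this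
    linear_combination this
  have h5 := Complex.abs_im_le_norm t
  have h6 : 2 * |l.im| * ‖t‖ ^ 2 ≤ ‖t‖ * (1 - ‖t‖ ^ 2) := by
    rw [h4]; gcongr; nlinarith
  have h7 : 2 * (|l.im| * ‖t‖) ≤ 1 - ‖t‖ ^ 2 := by
    by_contra! h
    nlinarith
  nlinarith

section Banach

variable {A : Type*} [NormedRing A] [NormedAlgebra ℂ A] [CompleteSpace A]

/-- The generating function of a bounded cosine sequence inverts `1 - 2 t x + t ^ 2` up to the
scalar `1 - t ^ 2`. -/
theorem exists_generating_function {c : ℕ → A} (h0 : c 0 = 1)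
    (hrec : ∀ n, c (n + 2) = 2 * c 1 * c (n + 1) - c n) (hcomm : ∀ n, Commute (c 1) (c n))
    {K : ℝ} (hK : ∀ n, ‖c n‖ ≤ K) {t : ℂ} (ht : ‖t‖ < 1) :
    ∃ p : A, ‖p‖ ≤ 3 * K / (1 - ‖t‖) ∧ Commute (c 1) p ∧
      ((1 + t ^ 2) • (1 : A) - (2 * t) • c 1) * p = (1 - t ^ 2) • (1 : A) := by
  have hK0 : 0 ≤ K := (norm_nonneg _).trans (hK 0)
  have hle (n : ℕ) : ‖t ^ n • c n‖ ≤ ‖t‖ ^ n * K := by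
    rw [norm_smul, norm_pow]; gcongr; exact hK n
  have hgeo : HasSum (fun n => ‖t‖ ^ n * K) ((1 - ‖t‖)⁻¹ * K) :=
    (hasSum_geometric_of_lt_one (norm_nonneg _) ht).mul_right K
  have hsum : Summable fun n => t ^ n • c n := .of_norm_bounded hgeo.summable hle
  have hS : ‖∑' n, t ^ n • c n‖ ≤ (1 - ‖t‖)⁻¹ * K := tsum_of_norm_bounded hgeo hle
  have hSc : Commute (c 1) (∑' n, t ^ n • c n) :=
    Commute.tsum_right _ fun n => (hcomm n).smul_right _
  have e1 : ∑' n, t ^ n • c n = 1 + ∑' n, t ^ (n + 1) • c (n + 1) := by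
    rw [hsum.tsum_eq_zero_add]; simp [h0]
  have hsum1 : Summable fun n => t ^ (n + 1) • c (n + 1) := (summable_nat_add_iff 1).2 hsum
  have e2 : ∑' n, t ^ (n + 1) • c (n + 1) = t • c 1 + ∑' n, t ^ (n + 2) • c (n + 2) := by
    rw [hsum1.tsum_eq_zero_add]; simp
  have e3 : ∑' n, t ^ (n + 2) • c (n + 2) =
      (2 * t) • (c 1 * ∑' n, t ^ (n + 1) • c (n + 1)) - t ^ 2 • ∑' n, t ^ n • c n := by
    rw [← hsum1.tsum_mul_left, ← (hsum1.mul_left (c 1)).tsum_const_smul,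
      ← hsum.tsum_const_smul, ← Summable.tsum_sub]
    · congr 1; ext n
      rw [hrec, two_mul, add_mul, mul_smul_comm]
      module
    · exact (hsum1.mul_left (c 1)).const_smul _
    · exact hsum.const_smul _
  set S := ∑' n, t ^ n • c n
  have e4 : ∑' n, t ^ (n + 1) • c (n + 1) = S - 1 := by rw [e1]; abel
  rw [e3, e4] at e2
  refine ⟨(2 : ℂ) • S - 1, ?_, (hSc.smul_right _).sub_right (Commute.one_right _), ?_⟩
  · have hpos : 0 < 1 - ‖t‖ := by linarith
    have h1 : ‖(1 : A)‖ ≤ K := h0 ▸ hK 0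
    have h2 : K ≤ K / (1 - ‖t‖) := by
      rw [le_div_iff₀ hpos]; nlinarith [norm_nonneg t]
    calc ‖(2 : ℂ) • S - 1‖ ≤ ‖(2 : ℂ) • S‖ + ‖(1 : A)‖ := norm_sub_le _ _
      _ ≤ 2 * ((1 - ‖t‖)⁻¹ * K) + K / (1 - ‖t‖) := by
        rw [norm_smul]; simp only [Complex.norm_ofNat]; gcongr; exact h1.trans h2
      _ = _ := by ring
  · simp only [mul_sub, sub_mul, smul_mul_assoc, mul_smul_comm, one_mul, mul_one] at e2 ⊢
    linear_combination (norm := module) (2 : ℂ) • e2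

/-- If `l = (t + t⁻¹) / 2` with `‖t‖ < 1`, then `l` lies in the resolvent set of `c 1`. -/
theorem exists_inverse_of_norm_lt_one {c : ℕ → A} (h0 : c 0 = 1)
    (hrec : ∀ n, c (n + 2) = 2 * c 1 * c (n + 1) - c n) (hcomm : ∀ n, Commute (c 1) (c n))
    {K : ℝ} (hK : ∀ n, ‖c n‖ ≤ K) {l t : ℂ} (ht : ‖t‖ < 1) (h : t ^ 2 + 1 = 2 * l * t) :
    ∃ r : A, (algebraMap ℂ A l - c 1) * r = 1 ∧ r * (algebraMap ℂ A l - c 1) = 1 ∧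
      ‖r‖ ≤ 6 * K * ‖t‖ / (1 - ‖t‖) ^ 2 := by
  obtain ⟨p, hp, hpc, hpe⟩ := exists_generating_function h0 hrec hcomm hK ht
  have hK0 : 0 ≤ K := (norm_nonneg _).trans (hK 0)
  have hpos : 0 < 1 - ‖t‖ := by linarith
  have hn : 1 - ‖t‖ ≤ ‖1 - t ^ 2‖ := by
    have := norm_sub_norm_le (1 : ℂ) (t ^ 2)
    rw [norm_one, norm_pow] at this
    nlinarith [norm_nonneg t]
  have hne : 1 - t ^ 2 ≠ 0 := norm_pos_iff.1 (hpos.trans_le hn)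
  have hmul : (algebraMap ℂ A l - c 1) * ((2 * t / (1 - t ^ 2)) • p) = 1 := by
    have : (1 + t ^ 2) • (1 : A) - (2 * t) • c 1 = (2 * t) • (algebraMap ℂ A l - c 1) := by
      rw [add_comm, h, Algebra.algebraMap_eq_smul_one]; module
    rw [this, smul_mul_assoc] at hpe
    rw [mul_smul_comm, div_eq_inv_mul, mul_smul, hpe, smul_smul, inv_mul_cancel₀ hne, one_smul]
  refine ⟨(2 * t / (1 - t ^ 2)) • p, hmul, ?_, ?_⟩
  · rw [← hmul]
    exact (((Algebra.commute_algebraMap_left l p).sub_left hpc).smul_right _).eq.symm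
  · rw [norm_smul, norm_div, norm_mul, Complex.norm_ofNat]
    calc 2 * ‖t‖ / ‖1 - t ^ 2‖ * ‖p‖ ≤ 2 * ‖t‖ / (1 - ‖t‖) * (3 * K / (1 - ‖t‖)) := by gcongr
      _ = _ := by field_simp; ring

theorem exists_inverse_of_im_ne_zero {c : ℕ → A} (h0 : c 0 = 1)
    (hrec : ∀ n, c (n + 2) = 2 * c 1 * c (n + 1) - c n) (hcomm : ∀ n, Commute (c 1) (c n))
    {K : ℝ} (hK : ∀ n, ‖c n‖ ≤ K) {l : ℂ} (hl : l.im ≠ 0) :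
    ∃ r : A, (algebraMap ℂ A l - c 1) * r = 1 ∧ r * (algebraMap ℂ A l - c 1) = 1 ∧
      ‖r‖ ≤ 6 * K * (2 * ‖l‖ + 1) / l.im ^ 2 := by
  obtain ⟨t, ht, h⟩ := exists_norm_le_one_sq_add_one l
  have hlt : ‖t‖ < 1 := ht.lt_of_ne fun h1 => hl (by rw [eq_ofReal_of_sq_add_one h1 h]; simp)
  obtain ⟨r, hr1, hr2, hr⟩ := exists_inverse_of_norm_lt_one h0 hrec hcomm hK hlt h
  refine ⟨r, hr1, hr2, hr.trans ?_⟩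
  have hK0 : 0 ≤ K := (norm_nonneg _).trans (hK 0)
  have ht0 : 0 < ‖t‖ := norm_pos_iff.2 (by rintro rfl; simp at h)
  have him := norm_mul_abs_im_le ht h
  have habs : 0 < |l.im| := abs_pos.2 hl
  have h1 : 1 ≤ ‖t‖ * (2 * ‖l‖ + 1) := by
    have : ‖(1 : ℂ)‖ ≤ ‖2 * l * t‖ + ‖t ^ 2‖ := by
      rw [show (1 : ℂ) = 2 * l * t - t ^ 2 by rw [← h]; ring]; exact norm_sub_le _ _
    simp at this
    nlinarith
  calc 6 * K * ‖t‖ / (1 - ‖t‖) ^ 2 ≤ 6 * K * ‖t‖ / (‖t‖ * |l.im|) ^ 2 := by gcongr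
    _ = 6 * K * (1 / ‖t‖) / l.im ^ 2 := by rw [mul_pow, sq_abs]; field_simp
    _ ≤ _ := by gcongr; rw [div_le_iff₀ ht0]; linarith

/-- If all `1 - w q` are invertible and the inverse grows at most like `‖w‖ ^ 3 / (im w) ^ 2`,
then `q ^ 2 = 0`. -/
theorem mul_self_eq_zero_of_inverse_growth {q : A} (hu : ∀ w : ℂ, IsUnit (1 - w • q)) {C : ℝ}
    (hC : ∀ w : ℂ, 1 ≤ ‖w‖ → w.im ≠ 0 → ‖Ring.inverse (1 - w • q)‖ ≤ C * ‖w‖ ^ 3 / w.im ^ 2) :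
    q * q = 0 := by
  have hC0 : 0 ≤ C := by simpa using (norm_nonneg _).trans (hC Complex.I (by simp) (by simp))
  set g : ℂ → A := fun w => Ring.inverse (1 - w • q) with hg
  have hgd : Differentiable ℂ g := fun w =>
    (differentiableAt_inverse (𝕜 := ℂ) (hu w)).comp w (f := fun w : ℂ => 1 - w • q) (by fun_prop)
  have hge (w : ℂ) : w • (q * g w) = g w - 1 := by
    have := Ring.mul_inverse_cancel _ (hu w)
    rw [sub_mul, one_mul, smul_mul_assoc] at this
    rw [← this]; simp [hg]
  have hlin (w : ℂ) (hw : 1 ≤ ‖w‖) : ‖g w‖ ≤ 16 * C * ‖w‖ := by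
    set R := 2 * ‖w‖ with hR
    have hRpos : 0 < R := by positivity
    have key : ‖(w ^ 2 - (R : ℂ) ^ 2) ^ 2 • g w‖ ≤ 4 * C * R ^ 5 := by
      refine Complex.norm_le_of_forall_mem_frontier_norm_le
        (f := fun w => (w ^ 2 - (R : ℂ) ^ 2) ^ 2 • g w) (U := Metric.ball 0 R)
        Metric.isBounded_ball (Differentiable.diffContOnCl (by fun_prop)) ?_ ?_
      · intro v hv
        rw [frontier_ball _ hRpos.ne', mem_sphere_zero_iff_norm] at hv
        have hv2 : ‖v ^ 2 - (R : ℂ) ^ 2‖ = 2 * R * |v.im| := by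
          have : v ^ 2 - (R : ℂ) ^ 2 = v * (v - (starRingEnd ℂ) v) := by
            rw [mul_sub, Complex.mul_conj, Complex.normSq_eq_norm_sq, hv]; push_cast; ring
          rw [this, norm_mul, hv, Complex.sub_conj]
          simp
          ring
        rw [norm_smul, norm_pow, hv2]
        by_cases him : v.im = 0
        · simp [him]; positivity
        · have := hC v (by rw [hv]; linarith) him
          rw [hv] at this
          calc (2 * R * |v.im|) ^ 2 * ‖g v‖
              ≤ (2 * R * |v.im|) ^ 2 * (C * R ^ 3 / v.im ^ 2) := by gcongr
            _ = 4 * C * R ^ 5 := by rw [mul_pow, sq_abs]; field_simp; ring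
      · apply subset_closure
        rw [mem_ball_zero_iff]; linarith
    have hlow : 3 * ‖w‖ ^ 2 ≤ ‖w ^ 2 - (R : ℂ) ^ 2‖ := by
      have := norm_sub_norm_le ((R : ℂ) ^ 2) (w ^ 2)
      rw [norm_sub_rev, norm_pow, norm_pow, Complex.norm_real, Real.norm_of_nonneg hRpos.le] at this
      nlinarith
    rw [norm_smul, norm_pow] at key
    have h1 : (3 * ‖w‖ ^ 2) ^ 2 * ‖g w‖ ≤ 4 * C * R ^ 5 :=
      le_trans (by gcongr) key
    have hw4 : 0 < ‖w‖ ^ 4 := by positivity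
    rw [hR] at h1
    have h2 : ‖w‖ ^ 4 * (9 * ‖g w‖) ≤ ‖w‖ ^ 4 * (128 * C * ‖w‖) := by linarith
    have h3 := le_of_mul_le_mul_left h2 hw4
    have : 0 ≤ C * ‖w‖ := by positivity
    linarith
  have hbdd : Bornology.IsBounded (Set.range fun w => q * g w) := by
    have hcont : Continuous fun w => q * g w := (hgd.const_mul q).continuous
    obtain ⟨B, hB⟩ := (isCompact_closedBall (0 : ℂ) 1).exists_bound_of_continuousOn
      hcont.continuousOn
    rw [isBounded_iff_forall_norm_le]
    refine ⟨max B (16 * C + ‖(1 : A)‖), ?_⟩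
    rintro _ ⟨w, rfl⟩
    rcases le_total ‖w‖ 1 with hw | hw
    · exact (hB w (by simpa using hw)).trans (le_max_left _ _)
    · refine le_trans ?_ (le_max_right _ _)
      have h1 : ‖w‖ * ‖q * g w‖ ≤ 16 * C * ‖w‖ + ‖(1 : A)‖ := by
        rw [← norm_smul, hge]
        exact (norm_sub_le _ _).trans (by gcongr; exact hlin w hw)
      have : ‖w‖ * ‖q * g w‖ ≤ ‖w‖ * (16 * C + ‖(1 : A)‖) := by
        nlinarith [norm_nonneg (1 : A)]
      exact le_of_mul_le_mul_left this (by linarith)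
  have hconst : q * g 1 = q * g 0 := (hgd.const_mul q).apply_eq_apply_of_bounded hbdd 1 0
  have hg0 : g 0 = 1 := by simp [hg]
  have hg1 := hge 1
  rw [hconst, hg0, one_smul, mul_one] at hg1
  rw [hg0, mul_one, eq_add_of_sub_eq hg1.symm, mul_add, mul_one] at hconst
  simpa using hconst

end Banach

theorem stmt_8 {A : Type*} [NormedRing A] [NormedAlgebra ℂ A] [CompleteSpace A]
    (c : ℤ → A) (hc0 : c 0 = 1)
    (hc : ∀ m n : ℤ, c (m + n) + c (m - n) = 2 * c m * c n)
    (hb : ∃ M : ℝ, ∀ n : ℤ, 1 ≤ n → ‖c n‖ ≤ M)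
    (hs : ∃ z : ℂ, spectrum ℂ (c 1) = {z}) :
    ∃ b : ℝ, ∀ n : ℤ, 1 ≤ n → c n = algebraMap ℂ A ((Real.cos (n * b) : ℝ)) := by
  obtain ⟨M, hM⟩ := hb
  obtain ⟨z, hz⟩ := hs
  have hrec (n : ℕ) : c ((n + 2 : ℕ) : ℤ) =
      2 * c ((1 : ℕ) : ℤ) * c ((n + 1 : ℕ) : ℤ) - c (n : ℤ) := by
    have heven : c (1 - ((n : ℤ) + 1)) = c n := by
      have h := hc 0 n
      rw [hc0, zero_add, mul_one, two_mul, zero_sub] at h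
      rw [show 1 - ((n : ℤ) + 1) = -n by ring]
      exact add_left_cancel h
    have h := hc 1 ((n : ℤ) + 1)
    rw [heven] at h
    push_cast
    rw [← h, show (1 : ℤ) + (n + 1) = n + 2 by ring]
    abel
  have hcomm (n : ℕ) : Commute (c ((1 : ℕ) : ℤ)) (c (n : ℤ)) := by
    induction n using Nat.twoStepInduction with
    | zero => simp [hc0]
    | one => exact Commute.refl _
    | more n ih1 ih2 =>
      rw [hrec]
      exact (((Commute.ofNat_right _ 2).mul_right (Commute.refl _)).mul_right ih2).sub_right ih1
  have hK (n : ℕ) : ‖c (n : ℤ)‖ ≤ max M ‖(1 : A)‖ := by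
    rcases Nat.eq_zero_or_pos n with rfl | hn
    · simp [hc0]
    · exact (hM n (by omega)).trans (le_max_left _ _)
  set K := max M ‖(1 : A)‖
  have hK0 : 0 ≤ K := (norm_nonneg _).trans (hK 0)
  have hc0' : c ((0 : ℕ) : ℤ) = 1 := hc0
  obtain ⟨b, rfl⟩ : ∃ b : ℝ, z = (Real.cos b : ℂ) := by
    obtain ⟨t, ht, h⟩ := exists_norm_le_one_sq_add_one z
    rcases ht.lt_or_eq with hlt | h1
    · obtain ⟨r, hr1, hr2, -⟩ :=
        exists_inverse_of_norm_lt_one (c := fun n : ℕ => c n) hc0' hrec hcomm hK hlt h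
      have hmem : z ∈ spectrum ℂ (c 1) := by rw [hz]; rfl
      exact absurd ⟨⟨_, r, hr1, hr2⟩, rfl⟩ (spectrum.mem_iff.1 hmem)
    · refine ⟨Real.arccos t.re, ?_⟩
      have h2 := abs_le.1 ((Complex.abs_re_le_norm t).trans h1.le)
      rw [eq_ofReal_of_sq_add_one h1 h, Real.cos_arccos h2.1 h2.2]
  set z : ℂ := (Real.cos b : ℂ) with hzdef
  have hzn : ‖z‖ ≤ 1 := by
    rw [hzdef, Complex.norm_real]; exact Real.abs_cos_le_one b
  set q : A := c 1 - algebraMap ℂ A z with hq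
  have hfac {w : ℂ} (hw : w ≠ 0) : w • (algebraMap ℂ A (z + w⁻¹) - c 1) = 1 - w • q := by
    rw [hq, map_add, Algebra.algebraMap_eq_smul_one, Algebra.algebraMap_eq_smul_one, smul_sub,
      smul_add, smul_smul w w⁻¹, mul_inv_cancel₀ hw]
    module
  have hq2 : q * q = 0 := by
    refine mul_self_eq_zero_of_inverse_growth (C := 30 * K) (fun w => ?_) fun w hw him => ?_
    · rcases eq_or_ne w 0 with rfl | hw
      · simp
      · have hnot : z + w⁻¹ ∉ spectrum ℂ (c 1) := by rw [hz]; simpa using hw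
        rw [spectrum.notMem_iff] at hnot
        rw [← hfac hw]
        exact hnot.smul (Units.mk0 w hw)
    · have hw0 : w ≠ 0 := by rintro rfl; simp at him
      have hwpos : 0 < ‖w‖ := norm_pos_iff.2 hw0
      have hlim : (z + w⁻¹).im = -w.im / ‖w‖ ^ 2 := by
        rw [Complex.add_im, hzdef, Complex.ofReal_im, Complex.inv_im, Complex.normSq_eq_norm_sq,
          zero_add]
      obtain ⟨r, hr1, hr2, hr⟩ := exists_inverse_of_im_ne_zero (c := fun n : ℕ => c n) hc0' hrec
        hcomm hK (l := z + w⁻¹) (by rw [hlim]; exact div_ne_zero (neg_ne_zero.2 him) (by positivity))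
      have hinv : Ring.inverse (1 - w • q) = w⁻¹ • r := by
        have e1 : (1 - w • q) * (w⁻¹ • r) = 1 := by
          rw [← hfac hw0, smul_mul_smul_comm, mul_inv_cancel₀ hw0, one_smul]; exact hr1
        have e2 : (w⁻¹ • r) * (1 - w • q) = 1 := by
          rw [← hfac hw0, smul_mul_smul_comm, inv_mul_cancel₀ hw0, one_smul]; exact hr2
        exact Ring.inverse_unit (⟨_, _, e1, e2⟩ : Aˣ)
      have hln : ‖z + w⁻¹‖ ≤ 2 := by
        refine (norm_add_le _ _).trans ?_
        rw [norm_inv]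
        linarith [inv_le_one_of_one_le₀ hw]
      rw [hinv, norm_smul, norm_inv]
      rw [hlim] at hr
      calc ‖w‖⁻¹ * ‖r‖ ≤ ‖w‖⁻¹ * (6 * K * (2 * 2 + 1) / (-w.im / ‖w‖ ^ 2) ^ 2) := by
            gcongr
            exact hr.trans (by gcongr)
        _ = 30 * K * ‖w‖ ^ 3 / w.im ^ 2 := by field_simp; ring
  have htaylor := cosine_eq_of_mul_self_eq_zero (c := fun n : ℕ => c n) hc0' hrec
    (z := z) (q := q) (by simp [hq]) hq2
  have hq0 : q = 0 := by
    by_contra hne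
    have hqpos : 0 < ‖q‖ := norm_pos_iff.2 hne
    have hT (n : ℕ) : ‖(Polynomial.Chebyshev.T ℂ n).eval z‖ ≤ 1 := by
      rw [hzdef, Complex.ofReal_cos, Polynomial.Chebyshev.T_complex_cos]
      have : Complex.cos (((n : ℤ) : ℂ) * b) = (Real.cos (n * b) : ℝ) := by push_cast; rfl
      rw [this, Complex.norm_real]
      exact Real.abs_cos_le_one _
    refine not_bounded_derivative_chebyshevT hzn ((K + ‖(1 : A)‖) / ‖q‖) fun n => ?_
    rw [le_div_iff₀ hqpos, ← norm_smul, ← sub_eq_iff_eq_add'.2 (htaylor n)]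
    refine (norm_sub_le _ _).trans (add_le_add (hK n) ?_)
    rw [norm_smul]
    exact mul_le_of_le_one_left (norm_nonneg _) (hT n)
  refine ⟨b, fun n hn => ?_⟩
  lift n to ℕ using by omega
  rw [htaylor n, hq0, smul_zero, add_zero, hzdef, Complex.ofReal_cos,
    Polynomial.Chebyshev.T_complex_cos, Algebra.algebraMap_eq_smul_one]
  push_cast
  rfl
end

section
/- Let G be an abelian group and let (C(g))_{g∈G} be a bounded cosine family in a commutative unital local Banach algebra A (i.e., A has a unique maximal ideal). Then C is scalar: there is a cosine family (c(g))_{g∈G} with values in [−1,1] such that C(g) = c(g)·1_A for all g ∈ G. -/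
/-- Every complex number `w` is of the form `(r + r⁻¹) / 2` with `‖r‖ ≤ 1`. -/
lemma exists_joukowski_preimage (w : ℂ) :
    ∃ r : ℂ, r ≠ 0 ∧ ‖r‖ ≤ 1 ∧ 2 * w = r + r⁻¹ := by
  obtain ⟨s, hs⟩ := IsSquare.exists_sq _ (IsAlgClosed.exists_eq_mul_self (w ^ 2 - 1))
  have hprod : (w + s) * (w - s) = 1 := by linear_combination hs
  have hne : w + s ≠ 0 := left_ne_zero_of_mul_eq_one hprod
  have hne' : w - s ≠ 0 := right_ne_zero_of_mul_eq_one hprod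
  have hinv : (w + s)⁻¹ = w - s := inv_eq_of_mul_eq_one_right hprod
  have hinv' : (w - s)⁻¹ = w + s := inv_eq_of_mul_eq_one_left hprod
  by_cases h : ‖w + s‖ ≤ 1
  · exact ⟨w + s, hne, h, by rw [hinv]; ring⟩
  · refine ⟨w - s, hne', ?_, by rw [hinv']; ring⟩
    rw [← hinv, norm_inv]
    exact inv_le_one_of_one_le₀ (le_of_not_ge h)

/-- If `r` lies in the unit disc and `w = (r + r⁻¹) / 2`, then `|Im w|` is controlled by
`(1 - ‖r‖) ‖1 - r ^ 2‖ / ‖r‖`. -/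
lemma abs_im_joukowski_le {r w : ℂ} (hr0 : r ≠ 0) (hr : ‖r‖ ≤ 1) (hw : 2 * w = r + r⁻¹) :
    ‖r‖ * |w.im| ≤ (1 - ‖r‖) * ‖1 - r ^ 2‖ := by
  have hpos : 0 < ‖r‖ := norm_pos_iff.mpr hr0
  have him : 2 * w.im * ‖r‖ ^ 2 = r.im * (‖r‖ ^ 2 - 1) := by
    have := congrArg Complex.im hw
    simp only [Complex.mul_im, Complex.add_im, Complex.inv_im, Complex.normSq_eq_norm_sq,
      Complex.re_ofNat, Complex.im_ofNat] at this
    field_simp at this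
    linear_combination this
  have hsub : |r.im| * (1 + ‖r‖ ^ 2) ≤ ‖r‖ * ‖1 - r ^ 2‖ := by
    have h1 : (starRingEnd ℂ r * (1 - r ^ 2)).im = -(r.im * (1 + ‖r‖ ^ 2)) := by
      have : starRingEnd ℂ r * (1 - r ^ 2) = starRingEnd ℂ r - ((‖r‖ ^ 2 : ℝ) : ℂ) * r := by
        have := Complex.conj_mul' r
        push_cast
        linear_combination (-r) * this
      rw [this, Complex.sub_im, Complex.conj_im, Complex.im_ofReal_mul]
      ring
    have h2 := Complex.abs_im_le_norm (starRingEnd ℂ r * (1 - r ^ 2))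
    rwa [h1, abs_neg, abs_mul, abs_of_pos (by positivity : 0 < 1 + ‖r‖ ^ 2), norm_mul,
      Complex.norm_conj] at h2
  have habs : 2 * |w.im| * ‖r‖ ^ 2 = |r.im| * (1 - ‖r‖ ^ 2) := by
    have := congrArg abs him
    rwa [abs_mul, abs_mul, abs_mul, abs_two, abs_of_nonneg (sq_nonneg ‖r‖),
      abs_of_nonpos (by nlinarith : ‖r‖ ^ 2 - 1 ≤ 0), neg_sub] at this
  have h3 : |r.im| ≤ ‖r‖ * ‖1 - r ^ 2‖ := by
    nlinarith [mul_nonneg (abs_nonneg r.im) (sq_nonneg ‖r‖)]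
  have h4 : 2 * |w.im| * ‖r‖ ^ 2 ≤ 2 * ((1 - ‖r‖) * (‖r‖ * ‖1 - r ^ 2‖)) := by
    rw [habs]
    calc |r.im| * (1 - ‖r‖ ^ 2) = |r.im| * ((1 - ‖r‖) * (1 + ‖r‖)) := by ring
      _ ≤ (‖r‖ * ‖1 - r ^ 2‖) * ((1 - ‖r‖) * 2) := by
        have : 0 ≤ 1 - ‖r‖ := by linarith
        gcongr
        linarith
      _ = _ := by ring
  refine le_of_mul_le_mul_left ?_ hpos
  nlinarith

section Chebyshev

variable {A : Type*} [NormedCommRing A] [NormedAlgebra ℂ A] [CompleteSpace A]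

/-- The Poisson-type generating function of a bounded sequence satisfying the Chebyshev
recurrence inverts `1 - 2 r a + r ^ 2` up to the factor `1 - r ^ 2`. -/
lemma exists_mul_eq_one_sub_sq {e : ℕ → A} {a : A} {M : ℝ} (h0 : e 0 = 1) (h1 : e 1 = a)
    (hrec : ∀ n, e (n + 2) = 2 * a * e (n + 1) - e n) (hM : ∀ n, ‖e n‖ ≤ M)
    {r : ℂ} (hr : ‖r‖ < 1) :
    ∃ S : A, S * (1 - (2 * r) • a + algebraMap ℂ A (r ^ 2)) = algebraMap ℂ A (1 - r ^ 2) ∧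
      (1 - ‖r‖) * ‖S‖ ≤ 3 * M := by
  have hM0 : 0 ≤ M := (norm_nonneg _).trans (hM 0)
  have hgeom : HasSum (fun n ↦ M * ‖r‖ ^ n) (M * (1 - ‖r‖)⁻¹) :=
    (hasSum_geometric_of_lt_one (norm_nonneg r) hr).mul_left M
  have hbound : ∀ n, ‖r ^ n • e n‖ ≤ M * ‖r‖ ^ n := fun n ↦ by
    rw [norm_smul, norm_pow, mul_comm]
    gcongr
    exact hM n
  have hsum : Summable fun n ↦ r ^ n • e n := .of_norm_bounded hgeom.summable hbound
  set P : A := ∑' n, r ^ n • e n with hP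
  have hPnorm : ‖P‖ ≤ M * (1 - ‖r‖)⁻¹ := tsum_of_norm_bounded hgeom hbound
  have hshift1 : P = 1 + ∑' n, r ^ (n + 1) • e (n + 1) := by
    rw [hP, hsum.tsum_eq_zero_add]; simp [h0]
  have hsum1 : Summable fun n ↦ r ^ (n + 1) • e (n + 1) := (summable_nat_add_iff 1).mpr hsum
  have hshift2 : ∑' n, r ^ (n + 1) • e (n + 1) = r • a + ∑' n, r ^ (n + 2) • e (n + 2) := by
    rw [hsum1.tsum_eq_zero_add]; simp [h1]
  have htail : ∑' n, r ^ (n + 2) • e (n + 2) =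
      (2 * r) • a * (∑' n, r ^ (n + 1) • e (n + 1)) - algebraMap ℂ A (r ^ 2) * P := by
    rw [hP, ← hsum1.tsum_mul_left, ← hsum.tsum_mul_left,
      ← (hsum1.mul_left _).tsum_sub (hsum.mul_left _)]
    refine tsum_congr fun n ↦ ?_
    rw [hrec]
    simp only [Algebra.smul_def, map_mul, map_pow, map_ofNat]
    ring
  have hmul : P * (1 - (2 * r) • a + algebraMap ℂ A (r ^ 2)) = 1 - r • a := by
    have h2 : (2 * r) • a = 2 * (r • a) := by
      simp only [Algebra.smul_def, map_mul, map_ofNat]; ring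
    rw [h2] at htail ⊢
    linear_combination (1 - 2 * (r • a)) * hshift1 + hshift2 + htail
  refine ⟨2 * P - 1, ?_, ?_⟩
  · have h2 : (2 * r) • a = 2 * (r • a) := by
      simp only [Algebra.smul_def, map_mul, map_ofNat]; ring
    rw [h2] at hmul ⊢
    rw [map_sub, map_one]
    linear_combination 2 * hmul
  · have hr' : 0 < 1 - ‖r‖ := by linarith
    have hone : ‖(1 : A)‖ ≤ M := h0 ▸ hM 0
    have hP' : (1 - ‖r‖) * ‖P‖ ≤ M := by
      calc (1 - ‖r‖) * ‖P‖ ≤ (1 - ‖r‖) * (M * (1 - ‖r‖)⁻¹) := by gcongr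
        _ = M := by field_simp
    have hS : ‖2 * P - 1‖ ≤ 2 * ‖P‖ + ‖(1 : A)‖ := by
      rw [two_mul, two_mul]
      exact (norm_sub_le _ _).trans (by gcongr; exact norm_add_le _ _)
    nlinarith [norm_nonneg r, norm_nonneg (1 : A)]

/-- Resolvent estimate off `[-1, 1]`. -/
lemma exists_resolvent_of_norm_lt_one {e : ℕ → A} {a : A} {M : ℝ} (h0 : e 0 = 1) (h1 : e 1 = a)
    (hrec : ∀ n, e (n + 2) = 2 * a * e (n + 1) - e n) (hM : ∀ n, ‖e n‖ ≤ M)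
    {r w : ℂ} (hr0 : r ≠ 0) (hr : ‖r‖ < 1) (hw : 2 * w = r + r⁻¹) :
    ∃ V : A, V * (algebraMap ℂ A w - a) = 1 ∧ |w.im| * ‖V‖ ≤ 6 * M := by
  obtain ⟨S, hS, hSn⟩ := exists_mul_eq_one_sub_sq h0 h1 hrec hM hr
  have hne : 1 - r ^ 2 ≠ 0 := by
    intro h
    have h' : ‖r‖ ^ 2 = 1 := by rw [← norm_pow, ← sub_eq_zero.mp h, norm_one]
    nlinarith [norm_nonneg r]
  have hfac : 1 - (2 * r) • a + algebraMap ℂ A (r ^ 2) =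
      (2 * r) • (algebraMap ℂ A w - a) := by
    have : 1 + r ^ 2 = 2 * r * w := by
      field_simp at hw
      linear_combination -hw
    have := congrArg (algebraMap ℂ A) this
    rw [map_add, map_one, map_mul] at this
    rw [smul_sub, Algebra.smul_def (2 * r) (algebraMap ℂ A w)]
    linear_combination this
  refine ⟨((1 - r ^ 2)⁻¹ * (2 * r)) • S, ?_, ?_⟩
  · rw [hfac, mul_smul_comm] at hS
    rw [smul_mul_assoc, mul_smul, hS, Algebra.smul_def, ← map_mul, inv_mul_cancel₀ hne, map_one]
  · have hpos : 0 < ‖1 - r ^ 2‖ := norm_pos_iff.mpr hne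
    have him := abs_im_joukowski_le hr0 hr.le hw
    rw [norm_smul, norm_mul, norm_inv, norm_mul, Complex.norm_ofNat]
    calc |w.im| * (‖1 - r ^ 2‖⁻¹ * (2 * ‖r‖) * ‖S‖)
        = 2 * (‖1 - r ^ 2‖⁻¹ * ((‖r‖ * |w.im|) * ‖S‖)) := by ring
      _ ≤ 2 * (‖1 - r ^ 2‖⁻¹ * (((1 - ‖r‖) * ‖1 - r ^ 2‖) * ‖S‖)) := by gcongr
      _ = 2 * ((1 - ‖r‖) * ‖S‖) := by field_simp
      _ ≤ 6 * M := by linarith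

end Chebyshev

/-- An element `b` with `1 - z b` invertible for all `z ∈ ℂ`, whose resolvent at the points
`l + z⁻¹`, `l` real, grows at most like `1 / |Im|`, is zero. -/
lemma eq_zero_of_norm_inverse_le {A : Type*} [NormedCommRing A] [NormedAlgebra ℂ A]
    [CompleteSpace A] {b : A} {K : ℝ} (hunit : ∀ z : ℂ, IsUnit (1 - z • b))
    (hK : ∀ z : ℂ, z.im ≠ 0 → |z.im| * ‖Ring.inverse (1 - z • b)‖ ≤ K * ‖z‖) : b = 0 := by
  have hK0 : 0 ≤ K := by
    have := hK Complex.I (by simp)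
    simp only [Complex.I_im, abs_one, one_mul, Complex.norm_I, mul_one] at this
    exact (norm_nonneg _).trans this
  have hder : ∀ z : ℂ, DifferentiableAt ℂ (fun z : ℂ ↦ Ring.inverse (1 - z • b)) z := fun z ↦ by
    have h : DifferentiableAt ℂ (Ring.inverse : A → A) (1 - z • b) :=
      differentiableAt_inverse (hunit z)
    exact DifferentiableAt.comp (f := fun z : ℂ ↦ 1 - z • b) z h (by fun_prop)
  have hder0 : HasDerivAt (fun z : ℂ ↦ Ring.inverse (1 - z • b)) b 0 := by
    have h : HasFDerivAt (Ring.inverse : A → A)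
        (-ContinuousLinearMap.mulLeftRight ℂ A 1 1) (1 - (0 : ℂ) • b) := by
      simpa using hasFDerivAt_ringInverse (𝕜 := ℂ) (1 : Aˣ)
    have h' : HasDerivAt (fun z : ℂ ↦ 1 - z • b) (-b) 0 := by
      simpa using ((hasDerivAt_id (0 : ℂ)).smul_const b).const_sub 1
    have h'' := h.comp_hasDerivAt 0 h'
    exact h''.congr_deriv (by simp)
  have key : ∀ R : ℝ, 0 < R → R * ‖b‖ ≤ 2 * K := fun R hR ↦ by
    set G : ℂ → A := fun z ↦ (z ^ 2 - (R : ℂ) ^ 2) • Ring.inverse (1 - z • b) with hG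
    have hGd : Differentiable ℂ G := fun z ↦ by
      have h : DifferentiableAt ℂ (fun z : ℂ ↦ z ^ 2 - (R : ℂ) ^ 2) z := by fun_prop
      exact h.smul (hder z)
    have hG0 : deriv G 0 = (-(R : ℂ) ^ 2) • b := by
      have h1 : HasDerivAt (fun z : ℂ ↦ z ^ 2 - (R : ℂ) ^ 2) 0 0 := by
        simpa using (hasDerivAt_pow 2 (0 : ℂ)).sub_const ((R : ℂ) ^ 2)
      exact (h1.smul hder0).deriv.trans (by simp)
    have hbd : ∀ z ∈ Metric.sphere (0 : ℂ) R, ‖G z‖ ≤ 2 * K * R ^ 2 := fun z hz ↦ by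
      have hzR : ‖z‖ = R := by simpa using hz
      have hfac : z ^ 2 - (R : ℂ) ^ 2 = z * (2 * z.im * Complex.I) := by
        rw [← hzR, ← Complex.mul_conj' z, ← Complex.ofReal_ofNat, ← Complex.ofReal_mul,
          ← Complex.sub_conj z]
        ring
      have hnorm : ‖z ^ 2 - (R : ℂ) ^ 2‖ = 2 * R * |z.im| := by
        rw [hfac]
        simp only [norm_mul, Complex.norm_ofNat, Complex.norm_real, Complex.norm_I, hzR,
          Real.norm_eq_abs]
        ring
      rw [hG, norm_smul, hnorm]
      by_cases him : z.im = 0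
      · simp only [him, abs_zero, mul_zero, zero_mul]; positivity
      · have := hK z him
        rw [hzR] at this
        nlinarith
    have hc := Complex.norm_deriv_le_of_forall_mem_sphere_norm_le hR hGd.diffContOnCl hbd
    rw [hG0, norm_smul, norm_neg, norm_pow, Complex.norm_real, Real.norm_of_nonneg hR.le,
      le_div_iff₀ hR] at hc
    refine le_of_mul_le_mul_left ?_ (by positivity : 0 < R ^ 2)
    nlinarith
  by_contra hb
  have hb' : 0 < ‖b‖ := norm_pos_iff.mpr hb
  have h := key ((2 * K + 1) / ‖b‖) (by positivity)
  rw [div_mul_cancel₀ _ hb'.ne'] at h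
  linarith

/-- In a local Banach algebra, an element whose Chebyshev sequence is bounded is a real scalar
in `[-1, 1]`. -/
lemma exists_eq_algebraMap_of_bounded_chebyshev {A : Type*} [NormedCommRing A]
    [NormedAlgebra ℂ A] [CompleteSpace A] [IsLocalRing A] {e : ℕ → A} {a : A} {M : ℝ}
    (h0 : e 0 = 1) (h1 : e 1 = a) (hrec : ∀ n, e (n + 2) = 2 * a * e (n + 1) - e n)
    (hM : ∀ n, ‖e n‖ ≤ M) :
    ∃ c : ℝ, c ∈ Set.Icc (-1 : ℝ) 1 ∧ a = algebraMap ℂ A (c : ℂ) := by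
  obtain ⟨l, hl⟩ := spectrum.nonempty a
  rw [spectrum.mem_iff] at hl
  obtain ⟨r, hr0, hr1, hr⟩ := exists_joukowski_preimage l
  have hrn : ‖r‖ = 1 := by
    by_contra hne
    obtain ⟨V, hV, -⟩ := exists_resolvent_of_norm_lt_one h0 h1 hrec hM hr0
      (lt_of_le_of_ne hr1 hne) hr
    exact hl (IsUnit.of_mul_eq_one_right V hV)
  have hlr : l = (r.re : ℂ) := by
    rw [Complex.inv_eq_conj hrn, Complex.add_conj] at hr
    push_cast at hr
    exact mul_left_cancel₀ two_ne_zero hr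
  refine ⟨r.re, abs_le.mp ((Complex.abs_re_le_norm r).trans hr1), ?_⟩
  rw [← hlr, ← sub_eq_zero]
  have hb : a - algebraMap ℂ A l ∈ nonunits A := by
    rwa [mem_nonunits_iff, ← IsUnit.neg_iff, neg_sub]
  have hunit : ∀ z : ℂ, IsUnit (1 - z • (a - algebraMap ℂ A l)) := fun z ↦ by
    rw [Algebra.smul_def]
    exact IsLocalRing.isUnit_one_sub_self_of_mem_nonunits _ (mul_mem_nonunits_right hb)
  refine eq_zero_of_norm_inverse_le (K := 6 * M) hunit fun z hz ↦ ?_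
  have hz0 : z ≠ 0 := by rintro rfl; simp at hz
  have hznorm : 0 < ‖z‖ := norm_pos_iff.mpr hz0
  have hwim : (l + z⁻¹).im = -z.im / ‖z‖ ^ 2 := by
    rw [hlr, Complex.add_im, Complex.ofReal_im, zero_add, Complex.inv_im,
      Complex.normSq_eq_norm_sq]
  obtain ⟨s, hs0, hs1, hs⟩ := exists_joukowski_preimage (l + z⁻¹)
  have hsn : ‖s‖ < 1 := by
    refine lt_of_le_of_ne hs1 fun hsn ↦ ?_
    rw [Complex.inv_eq_conj hsn, Complex.add_conj] at hs
    have him := congrArg Complex.im (mul_left_cancel₀ two_ne_zero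
      (hs.trans (by push_cast; rfl : _ = 2 * (s.re : ℂ))))
    rw [hwim, Complex.ofReal_im, div_eq_zero_iff, neg_eq_zero] at him
    exact him.elim hz (by positivity)
  obtain ⟨V, hV, hVn⟩ := exists_resolvent_of_norm_lt_one h0 h1 hrec hM hs0 hsn hs
  have hinv : Ring.inverse (1 - z • (a - algebraMap ℂ A l)) = z⁻¹ • V := by
    have hfac : 1 - z • (a - algebraMap ℂ A l) = z • (algebraMap ℂ A (l + z⁻¹) - a) := by
      have : algebraMap ℂ A z * algebraMap ℂ A z⁻¹ = 1 := by
        rw [← map_mul, mul_inv_cancel₀ hz0, map_one]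
      rw [Algebra.smul_def, Algebra.smul_def, map_add]
      linear_combination -this
    have hmul : z⁻¹ • V * (1 - z • (a - algebraMap ℂ A l)) = 1 := by
      rw [hfac, smul_mul_smul_comm, inv_mul_cancel₀ hz0, hV, one_smul]
    exact left_inv_eq_right_inv (Ring.inverse_mul_cancel _ (hunit z)) ((mul_comm _ _).trans hmul)
  rw [hwim, abs_div, abs_neg, abs_of_pos (by positivity : 0 < ‖z‖ ^ 2)] at hVn
  rw [hinv, norm_smul, norm_inv]
  calc |z.im| * (‖z‖⁻¹ * ‖V‖) = (|z.im| / ‖z‖ ^ 2 * ‖V‖) * ‖z‖ := by field_simp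
    _ ≤ 6 * M * ‖z‖ := by gcongr

theorem stmt_9 {G : Type*} [AddCommGroup G]
    {A : Type*} [NormedCommRing A] [NormedAlgebra ℂ A] [CompleteSpace A]
    (hloc : ∃! I : Ideal A, I.IsMaximal)
    (C : G → A) (hC0 : C 0 = 1)
    (hC : ∀ g h : G, C (g + h) + C (g - h) = 2 * C g * C h)
    (hb : ∃ M : ℝ, ∀ g : G, ‖C g‖ ≤ M) :
    ∃ c : G → ℝ, c 0 = 1 ∧
      (∀ g h : G, c (g + h) + c (g - h) = 2 * c g * c h) ∧
      (∀ g : G, c g ∈ Set.Icc (-1 : ℝ) 1) ∧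
      (∀ g : G, C g = algebraMap ℂ A ((c g : ℝ))) := by
  have : IsLocalRing A := IsLocalRing.of_unique_max_ideal hloc
  obtain ⟨M, hM⟩ := hb
  have hscalar : ∀ g, ∃ c : ℝ, c ∈ Set.Icc (-1 : ℝ) 1 ∧ C g = algebraMap ℂ A (c : ℂ) := fun g ↦ by
    refine exists_eq_algebraMap_of_bounded_chebyshev (e := fun n ↦ C (n • g)) (M := M)
      (by simpa using hC0) (by simp) (fun n ↦ ?_) (fun n ↦ hM _)
    have h := hC ((n + 1) • g) g
    have h1 : (n + 1) • g + g = (n + 2) • g := (succ_nsmul g (n + 1)).symm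
    have h2 : (n + 1) • g - g = n • g := by rw [succ_nsmul, add_sub_cancel_right]
    rw [h1, h2] at h
    linear_combination h
  choose c hc hCc using hscalar
  have hinj : Function.Injective fun x : ℝ ↦ algebraMap ℂ A (x : ℂ) :=
    (algebraMap ℂ A).injective.comp Complex.ofReal_injective
  refine ⟨c, hinj ?_, fun g h ↦ hinj ?_, hc, hCc⟩
  · simp [← hCc, hC0]
  · simp [← hCc, hC, map_ofNat (algebraMap ℂ A) 2]
end

section
/- Let (C(t))_{t∈ℝ} be a cosine function in a unital Banach algebra A. If sup_{t∈ℝ} ‖C(t) − cos(at)·1_A‖ < 8/(3√3) for some a ∈ ℝ, then C(t) = cos(at)·1_A for all t ∈ ℝ. -/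
open Filter Topology

lemma exists_three_mul_eq_of_cos_nat_mul_ge {θ : ℝ}
    (h : ∀ n : ℕ, -(3 / 5) ≤ Real.cos (n * θ)) : ∃ k : ℤ, 3 * θ = k * (2 * Real.pi) := by
  have hpi := Real.pi_pos
  have hS : ∀ x ∈ AddSubgroup.closure {θ, 2 * Real.pi}, -(3 / 5) ≤ Real.cos x := by
    intro x hx
    obtain ⟨j, k, rfl⟩ := AddSubgroup.mem_closure_pair.1 hx
    have h1 : j • θ + k • (2 * Real.pi) = j * θ + k * (2 * Real.pi) := by simp
    rw [h1, Real.cos_add_int_mul_two_pi]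
    obtain ⟨n, rfl | rfl⟩ := j.eq_nat_or_neg
    · simpa using h n
    · simpa [Real.cos_neg] using h n
  rcases AddSubgroup.dense_or_cyclic (AddSubgroup.closure {θ, 2 * Real.pi}) with hd | ⟨g, hg⟩
  · have hcl : IsClosed {x : ℝ | -(3 / 5) ≤ Real.cos x} :=
      isClosed_le continuous_const Real.continuous_cos
    have := hcl.closure_subset_iff.2 hS (hd Real.pi)
    simp only [Set.mem_ofPred_eq, Real.cos_pi] at this
    norm_num at this
  · have hmul : ∀ j : ℤ, -(3 / 5) ≤ Real.cos (j * g) := fun j ↦ hS _ <| by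
      rw [hg, AddSubgroup.mem_closure_singleton]
      exact ⟨j, by simp⟩
    have h2 : 2 * Real.pi ∈ AddSubgroup.closure {g} :=
      hg ▸ AddSubgroup.subset_closure (by simp)
    have h3 : θ ∈ AddSubgroup.closure {g} := hg ▸ AddSubgroup.subset_closure (by simp)
    obtain ⟨N, hN⟩ := AddSubgroup.mem_closure_singleton.1 h2
    obtain ⟨p, rfl⟩ := AddSubgroup.mem_closure_singleton.1 h3
    simp only [zsmul_eq_mul] at hN ⊢
    have key : ∀ n : ℕ, n * |g| = 2 * Real.pi → n ∣ 3 := by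
      intro n hn
      have habs : ∀ j : ℕ, -(3 / 5) ≤ Real.cos (j * |g|) := fun j ↦ by
        rw [← Real.cos_abs, abs_mul, abs_abs, ← abs_mul, Real.cos_abs]
        exact_mod_cast hmul j
      obtain ⟨r, hr | hr⟩ := n.even_or_odd'
      · have h4 : (r : ℝ) * |g| = Real.pi := by
          subst hr; push_cast at hn; linarith
        have := habs r
        rw [h4, Real.cos_pi] at this
        norm_num at this
      · by_cases hr2 : r ≤ 1
        · interval_cases r <;> simp [hr]
        · exfalso
          have hn5 : (5 : ℝ) ≤ n := by
            have : 5 ≤ n := by omega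
            exact_mod_cast this
          have hg0 := abs_nonneg g
          have h4 : (r : ℝ) * |g| = Real.pi - |g| / 2 := by
            subst hr; push_cast at hn; linarith
          have h5 := habs r
          rw [h4, Real.cos_pi_sub] at h5
          have h6 : Real.cos (Real.pi / 5) ≤ Real.cos (|g| / 2) := by
            apply Real.cos_le_cos_of_nonneg_of_le_pi <;> nlinarith
          rw [Real.cos_pi_div_five] at h6
          have : (2 : ℝ) ≤ √5 := Real.le_sqrt_of_sq_le (by norm_num)
          linarith
    have hdvd : N ∣ 3 := by
      rw [← Int.natAbs_dvd_natAbs]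
      apply key
      rw [← abs_of_pos (by positivity : (0 : ℝ) < 2 * Real.pi), ← hN, abs_mul, Nat.cast_natAbs]
      push_cast
      ring
    obtain ⟨q, hq⟩ := hdvd
    refine ⟨p * q, ?_⟩
    rw [← hN]
    have : (3 : ℝ) = N * q := by exact_mod_cast hq
    push_cast
    rw [this]
    ring

lemma eight_div_lt : 8 / (3 * √3) < (8 / 5 : ℝ) := by
  have : (5 / 3 : ℝ) < √3 := Real.lt_sqrt_of_sq_lt (by norm_num)
  gcongr
  linarith

lemma exists_cos_sub_cos_three_mul_eq :
    ∃ x : ℝ, Real.cos x - Real.cos (3 * x) = 8 / (3 * √3) := by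
  have h3 : (1 : ℝ) ≤ √3 := Real.le_sqrt_of_sq_le (by norm_num)
  have hsq : √3 ^ 2 = 3 := Real.sq_sqrt (by norm_num)
  have h1 : (√3)⁻¹ ≤ 1 := inv_le_one_of_one_le₀ h3
  have h0 : 0 ≤ (√3)⁻¹ := by positivity
  refine ⟨Real.arccos (√3)⁻¹, ?_⟩
  rw [Real.cos_three_mul, Real.cos_arccos (by linarith) h1]
  field_simp
  nlinarith

lemma eq_of_cos_mul_near_of_pos {α β m : ℝ} (hα : 0 < α) (hβ : 0 < β) (hm : m < 8 / (3 * √3))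
    (h : ∀ x : ℝ, |Real.cos (x * β) - Real.cos (x * α)| ≤ m) : α = β := by
  have hm' := hm.trans eight_div_lt
  have hex : ∀ {α β : ℝ}, 0 < α →
      (∀ x : ℝ, |Real.cos (x * β) - Real.cos (x * α)| ≤ m) → ∃ k : ℤ, 3 * β = k * α := by
    intro α β hα h
    obtain ⟨k, hk⟩ := exists_three_mul_eq_of_cos_nat_mul_ge (θ := 2 * Real.pi * β / α) <| by
      intro n
      have h1 := (abs_le.1 (h (n * (2 * Real.pi) / α))).1
      rw [div_mul_cancel₀ _ hα.ne', Real.cos_nat_mul_two_pi] at h1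
      rw [show (n : ℝ) * (2 * Real.pi * β / α) = n * (2 * Real.pi) / α * β by ring]
      linarith
    refine ⟨k, ?_⟩
    have hpi := Real.pi_pos
    field_simp at hk
    linarith
  have hne : ∀ {α : ℝ}, 0 < α →
      ¬ ∀ x : ℝ, |Real.cos (x * α) - Real.cos (x * (3 * α))| ≤ m := by
    intro α hα h
    obtain ⟨x, hx⟩ := exists_cos_sub_cos_three_mul_eq
    have h1 := le_of_abs_le (h (x / α))
    rw [div_mul_cancel₀ _ hα.ne', show x / α * (3 * α) = 3 * x by field_simp] at h1
    linarith
  have h' : ∀ x : ℝ, |Real.cos (x * α) - Real.cos (x * β)| ≤ m := fun x ↦ by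
    rw [abs_sub_comm]; exact h x
  obtain ⟨k, hk⟩ := hex hα h
  obtain ⟨l, hl⟩ := hex hβ h'
  have hk0 : 0 < k := by
    have : (0 : ℝ) < k := pos_of_mul_pos_left (hk ▸ by positivity) hα.le
    exact_mod_cast this
  have hkl : k * l = 9 := by
    have : (k : ℝ) * l = 9 := by
      have : (k * l - 9) * (α * β) = 0 := by linear_combination (-3 * β) * hl - l * β * hk
      have h4 := (mul_eq_zero.1 this).resolve_right (by positivity)
      linarith
    exact_mod_cast this
  have hk9 : k ≤ 9 := Int.le_of_dvd (by norm_num) ⟨l, hkl.symm⟩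
  interval_cases k <;> first | omega | skip
  · refine absurd h (?_ : ¬ _)
    rw [show α = 3 * β by push_cast at hk; linarith]
    exact hne hβ
  · push_cast at hk; linarith
  · refine absurd h' (?_ : ¬ _)
    rw [show β = 3 * α by push_cast at hk; linarith]
    exact hne hα

lemma cos_eq_cos_of_cos_mul_near {α β m : ℝ} (hm : m < 8 / (3 * √3))
    (h : ∀ x : ℝ, |Real.cos (x * β) - Real.cos (x * α)| ≤ m) : Real.cos α = Real.cos β := by
  have hm' := hm.trans eight_div_lt
  have habs : ∀ x y : ℝ, Real.cos (x * |y|) = Real.cos (x * y) := fun x y ↦ by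
    rw [← Real.cos_abs (x * y), ← Real.cos_abs (x * |y|), abs_mul, abs_mul, abs_abs]
  rcases eq_or_ne α 0 with rfl | hα
  · rcases eq_or_ne β 0 with rfl | hβ
    · rfl
    · have := abs_le.1 (h (Real.pi / β))
      rw [div_mul_cancel₀ _ hβ, mul_zero, Real.cos_pi, Real.cos_zero] at this
      linarith
  · rcases eq_or_ne β 0 with rfl | hβ
    · have := abs_le.1 (h (Real.pi / α))
      rw [div_mul_cancel₀ _ hα, mul_zero, Real.cos_pi, Real.cos_zero] at this
      linarith
    · rw [← Real.cos_abs α, ← Real.cos_abs β, eq_of_cos_mul_near_of_pos (abs_pos.2 hα)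
        (abs_pos.2 hβ) hm fun x ↦ by rw [habs, habs]; exact h x]

lemma Complex.im_eq_zero_of_norm_cos_nat_mul_le {z : ℂ} {M : ℝ}
    (h : ∀ n : ℕ, ‖Complex.cos (n * z)‖ ≤ M) : z.im = 0 := by
  have key : ∀ n : ℕ, n * |z.im| ≤ M := by
    intro n
    refine le_trans ?_ (h n)
    have h1 : ∀ w : ℂ, |w.im| ≤ ‖Complex.cos w‖ := by
      intro w
      have h2 : Complex.cos w = ((Real.cos w.re * Real.cosh w.im : ℝ) : ℂ)
          + ((-(Real.sin w.re * Real.sinh w.im) : ℝ) : ℂ) * Complex.I := by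
        rw [Complex.cos_eq]; push_cast; ring
      have h3 : |w.im| ≤ |Real.sinh w.im| := by
        rw [Real.abs_sinh]
        exact Real.self_le_sinh_iff.2 (abs_nonneg _)
      refine h3.trans (abs_le_of_sq_le_sq ?_ (norm_nonneg _))
      rw [← Complex.normSq_eq_norm_sq, h2, Complex.normSq_add_mul_I]
      nlinarith [Real.sin_sq_add_cos_sq w.re, Real.cosh_sq w.im]
    have := h1 (n * z)
    simpa [abs_mul] using this
  by_contra h0
  obtain ⟨n, hn⟩ := exists_nat_gt (M / |z.im|)
  rw [div_lt_iff₀ (abs_pos.2 h0)] at hn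
  exact absurd (key n) (not_le.2 hn)

lemma spectrum.norm_le_norm_of_mem' {A : Type*} [NormedRing A] [NormedAlgebra ℂ A]
    [CompleteSpace A] {x : A} {k : ℂ} (hk : k ∈ spectrum ℂ x) : ‖k‖ ≤ ‖x‖ := by
  by_contra! hlt
  rcases (norm_nonneg x).eq_or_lt with h0 | h0
  · have := spectrum.norm_le_norm_mul_of_mem hk
    rw [← h0, zero_mul] at this
    linarith
  · have h1 : ∀ n : ℕ, (‖k‖ / ‖x‖) ^ (n + 1) ≤ ‖(1 : A)‖ := fun n ↦ by
      have h2 := spectrum.norm_le_norm_mul_of_mem (spectrum.pow_mem_pow x (n + 1) hk)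
      rw [norm_pow] at h2
      rw [div_pow, div_le_iff₀ (by positivity), mul_comm]
      exact h2.trans (mul_le_mul_of_nonneg_right (norm_pow_le' x n.succ_pos) (norm_nonneg _))
    obtain ⟨n, hn⟩ := pow_unbounded_of_one_lt ‖(1 : A)‖ ((one_lt_div h0).2 hlt)
    have h3 := pow_le_pow_right₀ ((one_lt_div h0).2 hlt).le n.le_succ
    exact absurd (h1 n) (not_le.2 (hn.trans_le h3))

lemma exists_norm_pow_le_of_spectralRadius_lt_one {A : Type*} [NormedRing A] [NormedAlgebra ℂ A]
    [CompleteSpace A] {x : A} (hx : spectralRadius ℂ x < 1) : ∃ K : ℝ, ∀ n : ℕ, ‖x ^ n‖ ≤ K := by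
  have h := (spectrum.pow_norm_pow_one_div_tendsto_nhds_spectralRadius x).eventually_lt_const hx
  obtain ⟨N, hN⟩ := eventually_atTop.1 h
  obtain ⟨K, hK⟩ := ((Finset.range (N + 1)).image fun n ↦ ‖x ^ n‖).bddAbove
  refine ⟨max K 1, fun n ↦ ?_⟩
  rcases Nat.lt_or_ge n (N + 1) with hn | hn
  · exact le_max_of_le_left (hK (by simpa using ⟨n, by omega, rfl⟩))
  · apply le_max_of_le_right
    have h1 := hN n (by omega)
    rw [ENNReal.ofReal_lt_one] at h1
    by_contra! h2
    exact absurd (Real.one_le_rpow h2.le (by positivity)) (not_le.2 h1)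

/-- A power bounded solution of `4x - 2x² = e` is the small root. -/
lemma norm_le_half_of_four_mul_sub_two_mul_sq {A : Type*} [NormedRing A] [NormedAlgebra ℂ A]
    {x : A} {K : ℝ} (hK : ∀ n : ℕ, ‖x ^ n‖ ≤ K) (he : ‖4 * x - 2 * x ^ 2‖ < 2) :
    ‖x‖ ≤ ‖4 * x - 2 * x ^ 2‖ / 2 := by
  set e := 4 * x - 2 * x ^ 2 with hedef
  set ρ := ‖e‖ / 2 with hρ
  have hρ0 : 0 ≤ ρ := by positivity
  have hρ1 : ρ < 1 := by linarith
  let P : ℕ → A := fun n ↦ Nat.rec 0 (fun _ p ↦ (4⁻¹ : ℂ) • e + (2⁻¹ : ℂ) • p ^ 2) n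
  have hP : ∀ n, P (n + 1) = (4⁻¹ : ℂ) • e + (2⁻¹ : ℂ) • P n ^ 2 := fun _ ↦ rfl
  have hxe : Commute x e :=
    ((Commute.ofNat_right x 4).mul_right (Commute.refl x)).sub_right
      ((Commute.ofNat_right x 2).mul_right ((Commute.refl x).pow_right 2))
  have hcomm : ∀ n, Commute x (P n) := by
    intro n
    induction n with
    | zero => exact Commute.zero_right x
    | succ n ih =>
      rw [hP]
      exact (hxe.smul_right _).add_right ((ih.pow_right 2).smul_right _)
  have hPn : ∀ n, ‖P n‖ ≤ ρ := by
    intro n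
    induction n with
    | zero => simpa [P] using hρ0
    | succ n ih =>
      rw [hP]
      refine (norm_add_le _ _).trans ?_
      rw [norm_smul, norm_smul]
      have h1 : ‖P n ^ 2‖ ≤ ρ ^ 2 := (norm_pow_le' _ two_pos).trans (by gcongr)
      norm_num
      nlinarith
  have hstep : ∀ n, x - P (n + 1) = (2⁻¹ : ℂ) • (x * (x - P n) + (x - P n) * P n) := by
    intro n
    have h1 : x * (x - P n) + (x - P n) * P n = x ^ 2 - P n ^ 2 := by noncomm_ring
    have h2 : e = (4 : ℂ) • x - (2 : ℂ) • x ^ 2 := by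
      rw [hedef, ofNat_smul_eq_nsmul ℂ 4, ofNat_smul_eq_nsmul ℂ 2, nsmul_eq_mul, nsmul_eq_mul]; rfl
    rw [hP, h1, h2]
    module
  have hK0 : 0 ≤ K := (norm_nonneg _).trans (hK 0)
  have hbound : ∀ n j : ℕ, ‖x ^ j * (x - P n)‖ ≤ K * ((1 + ρ) / 2) ^ n := by
    intro n
    induction n with
    | zero => intro j; simpa [P, ← pow_succ] using hK (j + 1)
    | succ n ih =>
      intro j
      have h1 : x ^ j * (x - P (n + 1))
          = (2⁻¹ : ℂ) • (x ^ (j + 1) * (x - P n) + x ^ j * (x - P n) * P n) := by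
        rw [hstep, mul_smul_comm, mul_add, pow_succ, mul_assoc, mul_assoc]
      rw [h1, norm_smul, norm_inv, Complex.norm_ofNat]
      have h2 : ‖x ^ j * (x - P n) * P n‖ ≤ K * ((1 + ρ) / 2) ^ n * ρ :=
        (norm_mul_le _ _).trans (mul_le_mul (ih j) (hPn n) (norm_nonneg _) (by positivity))
      have h3 := (norm_add_le _ _).trans (add_le_add (ih (j + 1)) h2)
      rw [pow_succ ((1 + ρ) / 2)]
      linarith
  have hlim : Tendsto (fun n : ℕ ↦ ρ + K * ((1 + ρ) / 2) ^ n) atTop (𝓝 (ρ + K * 0)) :=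
    ((tendsto_pow_atTop_nhds_zero_of_lt_one (by positivity) (by linarith)).const_mul K).const_add ρ
  rw [mul_zero, add_zero] at hlim
  refine ge_of_tendsto' hlim fun n ↦ ?_
  have h1 := hbound n 0
  rw [pow_zero, one_mul] at h1
  have h2 := norm_add_le (P n) (x - P n)
  rw [add_sub_cancel] at h2
  linarith [hPn n]

section CosineFunction

variable {A : Type*} [NormedRing A] {C : ℝ → A}

lemma cosineFunction_neg (hC0 : C 0 = 1)
    (hC : ∀ s t : ℝ, C (s + t) + C (s - t) = 2 * C s * C t) (t : ℝ) : C (-t) = C t := by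
  have h := hC 0 t
  rw [hC0, zero_add, zero_sub, mul_one, two_mul] at h
  exact add_left_cancel h

lemma cosineFunction_two_mul (hC0 : C 0 = 1)
    (hC : ∀ s t : ℝ, C (s + t) + C (s - t) = 2 * C s * C t) (t : ℝ) :
    C (2 * t) = 2 * C t ^ 2 - 1 := by
  have h := hC t t
  rw [sub_self, hC0, ← two_mul] at h
  rw [eq_sub_of_add_eq h, sq, mul_assoc]

variable [NormedAlgebra ℂ A]

lemma cosineFunction_nat_mul (hC0 : C 0 = 1)
    (hC : ∀ s t : ℝ, C (s + t) + C (s - t) = 2 * C s * C t) (t : ℝ) (n : ℕ) :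
    C (n * t) = Polynomial.aeval (C t) (Polynomial.Chebyshev.T ℂ n) := by
  induction n using Nat.twoStepInduction with
  | zero => simp [hC0]
  | one => simp
  | more n ih0 ih1 =>
    have h := hC t ((n + 1 : ℕ) * t)
    rw [show t + (n + 1 : ℕ) * t = (n + 2 : ℕ) * t by push_cast; ring,
      show t - (n + 1 : ℕ) * t = -(n * t) by push_cast; ring, cosineFunction_neg hC0 hC, ih0, ih1] at h
    have h4 := Polynomial.Chebyshev.T_add_two ℂ n
    push_cast at h h4 ⊢
    rw [h4, eq_sub_of_add_eq h]
    simp [map_ofNat]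

lemma cos_nat_mul_mem_spectrum (hC0 : C 0 = 1)
    (hC : ∀ s t : ℝ, C (s + t) + C (s - t) = 2 * C s * C t) {t : ℝ} {z : ℂ}
    (hz : Complex.cos z ∈ spectrum ℂ (C t)) (n : ℕ) :
    Complex.cos (n * z) ∈ spectrum ℂ (C (n * t)) := by
  rw [cosineFunction_nat_mul hC0 hC]
  apply spectrum.subset_polynomial_aeval
  exact ⟨_, hz, by simp⟩

lemma exists_cos_mem_spectrum (hC0 : C 0 = 1)
    (hC : ∀ s t : ℝ, C (s + t) + C (s - t) = 2 * C s * C t) {t : ℝ} {l : ℂ} {n : ℕ} (hn : n ≠ 0)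
    (hl : l ∈ spectrum ℂ (C (n * t))) :
    ∃ z : ℂ, Complex.cos z ∈ spectrum ℂ (C t) ∧ Complex.cos (n * z) = l := by
  rw [cosineFunction_nat_mul hC0 hC, spectrum.map_polynomial_aeval_of_degree_pos] at hl
  · obtain ⟨k, hk, rfl⟩ := hl
    obtain ⟨z, rfl⟩ := Complex.cos_surjective k
    exact ⟨z, hk, by simp⟩
  · rw [Polynomial.Chebyshev.degree_T]
    simpa [Nat.pos_iff_ne_zero] using hn

variable [CompleteSpace A] {a m : ℝ}

lemma norm_sub_cos_le_of_mem_spectrum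
    (hbd : ∀ t : ℝ, ‖C t - algebraMap ℂ A ((Real.cos (a * t) : ℝ))‖ ≤ m) {t : ℝ} {l : ℂ}
    (hl : l ∈ spectrum ℂ (C t)) : ‖l - (Real.cos (a * t) : ℝ)‖ ≤ m :=
  (spectrum.norm_le_norm_of_mem' (by
    rw [spectrum.mem_iff, map_sub, sub_sub_sub_cancel_right]
    exact spectrum.mem_iff.1 hl)).trans (hbd t)

lemma exists_real_cos_eq_of_mem_spectrum (hC0 : C 0 = 1)
    (hC : ∀ s t : ℝ, C (s + t) + C (s - t) = 2 * C s * C t)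
    (hbd : ∀ t : ℝ, ‖C t - algebraMap ℂ A ((Real.cos (a * t) : ℝ))‖ ≤ m) {t : ℝ} {l : ℂ}
    (hl : l ∈ spectrum ℂ (C t)) :
    ∃ θ ∈ Set.Icc 0 Real.pi, l = (Real.cos θ : ℝ) := by
  obtain ⟨z, rfl⟩ := Complex.cos_surjective l
  have him : z.im = 0 := Complex.im_eq_zero_of_norm_cos_nat_mul_le (M := m + 1) fun n ↦ by
    have h1 := norm_sub_cos_le_of_mem_spectrum hbd (cos_nat_mul_mem_spectrum hC0 hC hl n)
    have h2 := norm_sub_norm_le (Complex.cos (n * z)) ((Real.cos (a * (n * t)) : ℝ) : ℂ)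
    have h3 : ‖((Real.cos (a * (n * t)) : ℝ) : ℂ)‖ ≤ 1 := by
      rw [Complex.norm_real]; exact Real.abs_cos_le_one _
    linarith
  have hz : z = (z.re : ℝ) := Complex.ext (by simp) (by simp [him])
  refine ⟨Real.arccos (Real.cos z.re), ⟨Real.arccos_nonneg _, Real.arccos_le_pi _⟩, ?_⟩
  rw [Real.cos_arccos (Real.neg_one_le_cos _) (Real.cos_le_one _), Complex.ofReal_cos, ← hz]

lemma abs_cos_nat_mul_sub_cos_le (hC0 : C 0 = 1)
    (hC : ∀ s t : ℝ, C (s + t) + C (s - t) = 2 * C s * C t)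
    (hbd : ∀ t : ℝ, ‖C t - algebraMap ℂ A ((Real.cos (a * t) : ℝ))‖ ≤ m) {t θ : ℝ}
    (hl : ((Real.cos θ : ℝ) : ℂ) ∈ spectrum ℂ (C t)) (n : ℕ) :
    |Real.cos (n * θ) - Real.cos (n * (a * t))| ≤ m := by
  rw [Complex.ofReal_cos] at hl
  have h := norm_sub_cos_le_of_mem_spectrum hbd (cos_nat_mul_mem_spectrum hC0 hC hl n)
  rw [show a * (n * t) = n * (a * t) by ring] at h
  have h2 : Complex.cos (n * θ) - (Real.cos (n * (a * t)) : ℝ)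
      = ((Real.cos (n * θ) - Real.cos (n * (a * t)) : ℝ) : ℂ) := by push_cast; rfl
  rwa [h2, Complex.norm_real] at h

/-- For small times, the spectrum of the cosine function lies close to `1`. -/
lemma exists_forall_cos_mem_spectrum_gt (hC0 : C 0 = 1)
    (hC : ∀ s t : ℝ, C (s + t) + C (s - t) = 2 * C s * C t) (hm : m < 8 / (3 * √3))
    (hbd : ∀ t : ℝ, ‖C t - algebraMap ℂ A ((Real.cos (a * t) : ℝ))‖ ≤ m) :
    ∃ ε > 0, ∀ t, |t| ≤ ε → ∀ θ : ℝ, ((Real.cos θ : ℝ) : ℂ) ∈ spectrum ℂ (C t) →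
      1 / 2 < Real.cos θ := by
  by_contra! hcon
  choose t ht θ hθ hθ2 using fun n : ℕ ↦ hcon (1 / (n + 1 : ℝ)) (by positivity)
  have hμ : ∀ n, ∃ φ ∈ Set.Icc 0 Real.pi,
      ((Real.cos φ : ℝ) : ℂ) ∈ spectrum ℂ (C (t n / 3)) ∧ Real.cos (3 * φ) = Real.cos (θ n) := by
    intro n
    have h1 := hθ n
    rw [show t n = (3 : ℕ) * (t n / 3) by push_cast; ring] at h1
    obtain ⟨z, hz, hz3⟩ := exists_cos_mem_spectrum hC0 hC three_ne_zero h1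
    obtain ⟨φ, hφ, hφz⟩ := exists_real_cos_eq_of_mem_spectrum hC0 hC hbd hz
    refine ⟨φ, hφ, hφz ▸ hz, ?_⟩
    have h4 : Complex.cos (3 * z) = Complex.cos (3 * φ) := by
      rw [Complex.cos_three_mul, Complex.cos_three_mul, hφz, Complex.ofReal_cos]
    have h5 : ((Real.cos (3 * φ) : ℝ) : ℂ) = (Real.cos (θ n) : ℝ) := by
      rw [← hz3]; push_cast; exact h4.symm
    exact_mod_cast h5
  choose φ hφ hφs hφ3 using hμ
  obtain ⟨ψ, -, f, hf, hlim⟩ := isCompact_Icc.tendsto_subseq hφ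
  have htlim : Tendsto (fun n ↦ t (f n)) atTop (𝓝 0) := by
    have : Tendsto t atTop (𝓝 0) := squeeze_zero_norm ht tendsto_one_div_add_atTop_nhds_zero_nat
    exact this.comp hf.tendsto_atTop
  have hj : ∀ j : ℕ, -(3 / 5) ≤ Real.cos (j * ψ) := by
    intro j
    have h1 : Tendsto (fun n ↦ |Real.cos (j * φ (f n)) - Real.cos (j * (a * (t (f n) / 3)))|) atTop
        (𝓝 |Real.cos (j * ψ) - Real.cos (j * (a * (0 / 3)))|) := by
      refine (Tendsto.sub ?_ ?_).abs
      · exact (Real.continuous_cos.tendsto _).comp (hlim.const_mul _)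
      · exact (Real.continuous_cos.tendsto _).comp
          (((htlim.div_const 3).const_mul a).const_mul _)
    have h2 := le_of_tendsto' h1 fun n ↦ abs_cos_nat_mul_sub_cos_le hC0 hC hbd (hφs (f n)) j
    simp only [zero_div, mul_zero, Real.cos_zero] at h2
    have := (abs_le.1 h2).1
    have := hm.trans eight_div_lt
    linarith
  obtain ⟨k, hk⟩ := exists_three_mul_eq_of_cos_nat_mul_ge hj
  have h1 : Tendsto (fun n ↦ Real.cos (3 * φ (f n))) atTop (𝓝 (Real.cos (3 * ψ))) :=
    (Real.continuous_cos.tendsto _).comp (hlim.const_mul _)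
  rw [hk, Real.cos_int_mul_two_pi] at h1
  have := le_of_tendsto' h1 fun n ↦ (hφ3 (f n)).trans_le (hθ2 (f n))
  norm_num at this

lemma eq_cos_of_mem_spectrum (hC0 : C 0 = 1)
    (hC : ∀ s t : ℝ, C (s + t) + C (s - t) = 2 * C s * C t) (hm : m < 8 / (3 * √3))
    (hbd : ∀ t : ℝ, ‖C t - algebraMap ℂ A ((Real.cos (a * t) : ℝ))‖ ≤ m) {t : ℝ} {l : ℂ}
    (hl : l ∈ spectrum ℂ (C t)) : l = (Real.cos (a * t) : ℝ) := by
  obtain ⟨ε, hε, hsmall⟩ := exists_forall_cos_mem_spectrum_gt hC0 hC hm hbd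
  have key : ∀ s, |s| ≤ ε → ∀ β ∈ Set.Icc 0 Real.pi,
      ((Real.cos β : ℝ) : ℂ) ∈ spectrum ℂ (C s) → Real.cos (a * s) = Real.cos β := by
    intro s hs β hβ hβs
    have hhalf : ∀ j : ℕ, ((Real.cos (β / 2 ^ j) : ℝ) : ℂ) ∈ spectrum ℂ (C (s / 2 ^ j)) := by
      intro j
      induction j with
      | zero => simpa using hβs
      | succ j ih =>
        rw [show s / 2 ^ j = (2 : ℕ) * (s / 2 ^ (j + 1)) by rw [pow_succ]; push_cast; field_simp]
          at ih
        obtain ⟨z, hz, hz2⟩ := exists_cos_mem_spectrum hC0 hC two_ne_zero ih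
        obtain ⟨φ, hφ, hφz⟩ := exists_real_cos_eq_of_mem_spectrum hC0 hC hbd hz
        rw [hφz] at hz
        have h2j : (1 : ℝ) ≤ 2 ^ (j + 1) := one_le_pow₀ (by norm_num)
        have hφpos := hsmall (s / 2 ^ (j + 1)) (by
          rw [abs_div, abs_of_pos (by positivity : (0 : ℝ) < 2 ^ (j + 1))]
          exact (div_le_self (abs_nonneg _) h2j).trans hs) φ hz
        have hsq : Real.cos φ ^ 2 = Real.cos (β / 2 ^ (j + 1)) ^ 2 := by
          have h4 : Complex.cos (2 * z) = Complex.cos (2 * φ) := by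
            rw [Complex.cos_two_mul, Complex.cos_two_mul, hφz, Complex.ofReal_cos]
          have h5 : ((Real.cos (2 * φ) : ℝ) : ℂ) = (Real.cos (β / 2 ^ j) : ℝ) := by
            rw [← hz2]; push_cast; exact h4.symm
          have h6 : Real.cos (2 * φ) = Real.cos (2 * (β / 2 ^ (j + 1))) := by
            rw [show 2 * (β / 2 ^ (j + 1)) = β / 2 ^ j by rw [pow_succ]; field_simp]
            exact_mod_cast h5
          rw [Real.cos_two_mul, Real.cos_two_mul] at h6
          linarith
        have hnn : 0 ≤ Real.cos (β / 2 ^ (j + 1)) := by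
          have h2j' : (2 : ℝ) ≤ 2 ^ (j + 1) := by
            rw [pow_succ]; linarith [one_le_pow₀ (M₀ := ℝ) (n := j) one_le_two]
          have : β / 2 ^ (j + 1) ≤ Real.pi / 2 :=
            div_le_div₀ Real.pi_pos.le hβ.2 two_pos h2j'
          have h0 : 0 ≤ β / 2 ^ (j + 1) := div_nonneg hβ.1 (by positivity)
          exact Real.cos_nonneg_of_mem_Icc ⟨by linarith [Real.pi_pos], this⟩
        rwa [← (sq_eq_sq₀ (by linarith) hnn).1 hsq]
    apply cos_eq_cos_of_cos_mul_near hm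
    have hnonneg : ∀ x : ℝ, 0 ≤ x → |Real.cos (x * β) - Real.cos (x * (a * s))| ≤ m := by
      intro x hx
      have hx' : Tendsto (fun j : ℕ ↦ (⌊x * 2 ^ j⌋₊ : ℝ) / 2 ^ j) atTop (𝓝 x) :=
        (tendsto_nat_floor_mul_div_atTop hx).comp
          (tendsto_pow_atTop_atTop_of_one_lt (one_lt_two (α := ℝ)))
      have h1 : Tendsto (fun j : ℕ ↦ |Real.cos ((⌊x * 2 ^ j⌋₊ : ℝ) / 2 ^ j * β)
          - Real.cos ((⌊x * 2 ^ j⌋₊ : ℝ) / 2 ^ j * (a * s))|) atTop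
          (𝓝 |Real.cos (x * β) - Real.cos (x * (a * s))|) := by
        refine (Tendsto.sub ?_ ?_).abs
        · exact (Real.continuous_cos.tendsto _).comp (hx'.mul_const _)
        · exact (Real.continuous_cos.tendsto _).comp (hx'.mul_const _)
      refine le_of_tendsto' h1 fun j ↦ ?_
      have := abs_cos_nat_mul_sub_cos_le hC0 hC hbd (hhalf j) ⌊x * 2 ^ j⌋₊
      rwa [← mul_div_assoc, ← mul_div_assoc, ← mul_div_assoc, ← div_mul_eq_mul_div,
        ← div_mul_eq_mul_div] at this
    intro x
    rcases le_total 0 x with hx | hx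
    · exact hnonneg x hx
    · have := hnonneg (-x) (neg_nonneg.2 hx)
      rwa [neg_mul, neg_mul, Real.cos_neg, Real.cos_neg] at this
  obtain ⟨n, hn⟩ := exists_nat_gt (|t| / ε)
  have hn0 : (0 : ℝ) < n := (by positivity : 0 ≤ |t| / ε).trans_lt hn
  have hnt : t = n * (t / n) := by field_simp
  rw [hnt] at hl
  obtain ⟨z, hz, rfl⟩ := exists_cos_mem_spectrum hC0 hC (by exact_mod_cast hn0.ne') hl
  obtain ⟨φ, hφ, hφz⟩ := exists_real_cos_eq_of_mem_spectrum hC0 hC hbd hz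
  have h1 := key (t / n) (by
    rw [abs_div, abs_of_pos hn0, div_le_iff₀ hn0, mul_comm]
    exact ((div_lt_iff₀ hε).1 hn).le) φ hφ (hφz ▸ hz)
  rw [← h1] at hφz
  have h2 := Polynomial.Chebyshev.T_complex_cos z n
  rw [hφz, Complex.ofReal_cos, Polynomial.Chebyshev.T_complex_cos] at h2
  have h3 : ((n : ℤ) : ℂ) = (n : ℂ) := by push_cast; rfl
  rw [h3] at h2
  rw [← h2, Complex.ofReal_cos]
  congr 1
  have hn0' : (n : ℂ) ≠ 0 := by exact_mod_cast hn0.ne'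
  push_cast
  field_simp

lemma norm_one_sub_le_half (hC0 : C 0 = 1)
    (hC : ∀ s t : ℝ, C (s + t) + C (s - t) = 2 * C s * C t)
    (hσ : ∀ t : ℝ, ∀ l ∈ spectrum ℂ (C t), l = (Real.cos (a * t) : ℝ)) {t : ℝ}
    (hcos : 0 < Real.cos (a * t)) (h2 : ‖1 - C (2 * t)‖ < 2) :
    ‖1 - C t‖ ≤ ‖1 - C (2 * t)‖ / 2 := by
  nontriviality A
  have heq : 4 * (1 - C t) - 2 * (1 - C t) ^ 2 = 1 - C (2 * t) := by
    rw [cosineFunction_two_mul hC0 hC]; noncomm_ring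
  have hrad : spectralRadius ℂ (1 - C t) < 1 := by
    refine spectrum.spectralRadius_lt_of_forall_lt (r := 1) _ fun k hk ↦ ?_
    have h1 : 1 - k ∈ spectrum ℂ (C t) := by
      rw [spectrum.mem_iff] at hk ⊢
      rwa [← IsUnit.neg_iff, show -(algebraMap ℂ A (1 - k) - C t)
        = algebraMap ℂ A k - (1 - C t) by rw [map_sub, map_one]; abel]
    have h3 := hσ t _ h1
    have h4 : k = ((1 - Real.cos (a * t) : ℝ) : ℂ) := by
      rw [Complex.ofReal_sub, ← h3]; simp
    rw [← NNReal.coe_lt_coe, coe_nnnorm, h4, Complex.norm_real, Real.norm_eq_abs, NNReal.coe_one,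
      abs_lt]
    constructor <;> linarith [Real.cos_le_one (a * t)]
  obtain ⟨K, hK⟩ := exists_norm_pow_le_of_spectralRadius_lt_one hrad
  have := norm_le_half_of_four_mul_sub_two_mul_sq hK (by rwa [heq])
  rwa [heq] at this

lemma eq_one_of_cos_eq_one (hC0 : C 0 = 1)
    (hC : ∀ s t : ℝ, C (s + t) + C (s - t) = 2 * C s * C t) (hm : m < 2)
    (hbd : ∀ t : ℝ, ‖C t - algebraMap ℂ A ((Real.cos (a * t) : ℝ))‖ ≤ m)
    (hσ : ∀ t : ℝ, ∀ l ∈ spectrum ℂ (C t), l = (Real.cos (a * t) : ℝ)) {t : ℝ}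
    (hcos : Real.cos (a * t) = 1) : C t = 1 := by
  have hle : ∀ s : ℝ, Real.cos (a * s) = 1 → ‖1 - C s‖ ≤ m := fun s hs ↦ by
    simpa [hs, norm_sub_rev] using hbd s
  have key : ∀ (j : ℕ) (s : ℝ), Real.cos (a * s) = 1 → ‖1 - C s‖ ≤ m / 2 ^ j := by
    intro j
    induction j with
    | zero => simpa using hle
    | succ j ih =>
      intro s hs
      have h2 : Real.cos (a * (2 * s)) = 1 := by
        rw [mul_left_comm, Real.cos_two_mul, hs]; norm_num
      have h3 := norm_one_sub_le_half hC0 hC hσ (hs ▸ one_pos) ((hle _ h2).trans_lt hm)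
      have h4 := ih _ h2
      rw [pow_succ, ← div_div]
      linarith
  have hlim : Tendsto (fun j : ℕ ↦ m / 2 ^ j) atTop (𝓝 0) :=
    tendsto_const_nhds.div_atTop (tendsto_pow_atTop_atTop_of_one_lt one_lt_two)
  have h0 := ge_of_tendsto' hlim fun j ↦ key j t hcos
  exact (sub_eq_zero.1 (norm_le_zero_iff.1 h0)).symm

omit [CompleteSpace A] in
/-- A bounded cosine function is periodic with period any `p` such that `C p = 1`. -/
lemma cosineFunction_add_eq_of_eq_one
    (hC : ∀ s t : ℝ, C (s + t) + C (s - t) = 2 * C s * C t) {M : ℝ} (hM : ∀ t, ‖C t‖ ≤ M)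
    {p : ℝ} (hp : C p = 1) (t : ℝ) : C (t + p) = C t := by
  have harith : ∀ n : ℕ, C (t + n * p) = C t + n • (C (t + p) - C t) := by
    intro n
    induction n using Nat.twoStepInduction with
    | zero => simp
    | one => simp
    | more n ih0 ih1 =>
      have h := hC (t + (n + 1 : ℕ) * p) p
      rw [hp, mul_one, show t + (n + 1 : ℕ) * p + p = t + (n + 2 : ℕ) * p by push_cast; ring,
        show t + (n + 1 : ℕ) * p - p = t + n * p by push_cast; ring, ih0, ih1] at h
      rw [eq_sub_of_add_eq h, two_mul, add_smul, add_smul, one_smul, two_smul]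
      abel
  have hbound : ∀ n : ℕ, n * ‖C (t + p) - C t‖ ≤ 2 * M := fun n ↦ by
    have h1 : (n : ℂ) • (C (t + p) - C t) = C (t + n * p) - C t := by
      rw [harith n, Nat.cast_smul_eq_nsmul]; abel
    have h2 : ‖(n : ℂ) • (C (t + p) - C t)‖ = n * ‖C (t + p) - C t‖ := by
      rw [norm_smul, Complex.norm_natCast]
    rw [← h2, h1]
    linarith [norm_sub_le (C (t + n * p)) (C t), hM (t + n * p), hM t]
  by_contra hne
  have hpos := norm_pos_iff.2 (sub_ne_zero.2 hne)
  obtain ⟨n, hn⟩ := exists_nat_gt (2 * M / ‖C (t + p) - C t‖)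
  exact absurd (hbound n) (not_le.2 ((div_lt_iff₀ hpos).1 hn))

omit [CompleteSpace A] in
lemma eq_cos_half (hC0 : C 0 = 1)
    (hC : ∀ s t : ℝ, C (s + t) + C (s - t) = 2 * C s * C t) {M : ℝ} (hM : ∀ t, ‖C t‖ ≤ M)
    (hσ : ∀ t : ℝ, ∀ l ∈ spectrum ℂ (C t), l = (Real.cos (a * t) : ℝ)) {t : ℝ}
    (h2 : C (2 * t) = algebraMap ℂ A (Real.cos (a * (2 * t)) : ℝ)) :
    C t = algebraMap ℂ A (Real.cos (a * t) : ℝ) := by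
  by_cases hc : Real.cos (a * t) = 0
  · have h3 : C (2 * t) = -1 := by
      rw [h2, mul_left_comm, Real.cos_two_mul, hc]; simp
    have h4 : C (2 * (2 * t)) = 1 := by
      rw [cosineFunction_two_mul hC0 hC, h3]; noncomm_ring
    have h5 := cosineFunction_add_eq_of_eq_one hC hM h4 (-t)
    have h6 := hC (2 * t) t
    rw [show -t + 2 * (2 * t) = 2 * t + t by ring, cosineFunction_neg hC0 hC] at h5
    rw [h5, show 2 * t - t = t by ring, h3] at h6
    have h7 : (4 : ℂ) • C t = 0 := by
      have : (4 : ℂ) • C t = C t + C t - 2 * -1 * C t := by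
        rw [ofNat_smul_eq_nsmul]
        noncomm_ring
      rw [this, h6, sub_self]
    rw [hc]
    simpa using h7
  · set c : ℂ := ((Real.cos (a * t) : ℝ) : ℂ) with hcdef
    have hc' : c ≠ 0 := Complex.ofReal_ne_zero.2 hc
    have hunit : IsUnit (algebraMap ℂ A (-c) - C t) := by
      rw [← spectrum.notMem_iff]
      intro hmem
      exact hc' (self_eq_neg.1 (hσ t _ hmem).symm)
    have hsq : C t ^ 2 = algebraMap ℂ A (c ^ 2) := by
      have h3 := cosineFunction_two_mul hC0 hC t
      rw [h2, mul_left_comm, Real.cos_two_mul] at h3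
      rw [Complex.ofReal_sub, Complex.ofReal_one, map_sub, map_one, sub_left_inj,
        Complex.ofReal_mul, map_mul, Complex.ofReal_pow, ← hcdef, Complex.ofReal_ofNat,
        map_ofNat] at h3
      have h4 : (2 : ℂ) • algebraMap ℂ A (c ^ 2) = (2 : ℂ) • C t ^ 2 := by
        rw [two_smul, two_smul, ← two_mul, ← two_mul]
        exact h3
      exact ((smul_right_injective A two_ne_zero) h4).symm
    have hmul : (algebraMap ℂ A (-c) - C t) * (C t - algebraMap ℂ A c) = 0 := by
      have hcomm := Algebra.commutes c (C t)
      have : (algebraMap ℂ A (-c) - C t) * (C t - algebraMap ℂ A c)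
          = algebraMap ℂ A (c ^ 2) - C t ^ 2 + (C t * algebraMap ℂ A c - algebraMap ℂ A c * C t) := by
        rw [map_neg, map_pow]; noncomm_ring
      rw [this, hsq, hcomm]; simp
    exact sub_eq_zero.1 ((hunit.mul_right_eq_zero).1 hmul)

omit [CompleteSpace A] in
lemma continuous_of_norm_one_sub_le_half
    (hC : ∀ s t : ℝ, C (s + t) + C (s - t) = 2 * C s * C t) {M : ℝ} (hM : ∀ t, ‖C t‖ ≤ M)
    {ε : ℝ} (hε : 0 < ε) (hlt : ∀ t, |t| ≤ ε → ‖1 - C t‖ < 2)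
    (hhalf : ∀ t, |2 * t| ≤ ε → ‖1 - C t‖ ≤ ‖1 - C (2 * t)‖ / 2) : Continuous C := by
  have hscale : ∀ {k : ℕ} {h : ℝ}, |h| ≤ ε / 2 ^ (k + 1) → |2 * h| ≤ ε / 2 ^ k := by
    intro k h hh
    rw [abs_mul, abs_two]
    rw [pow_succ, ← div_div] at hh
    linarith
  have hle : ∀ k : ℕ, ε / 2 ^ k ≤ ε := fun k ↦
    div_le_self hε.le (one_le_pow₀ one_le_two)
  have hone : ∀ (k : ℕ) (h : ℝ), |h| ≤ ε / 2 ^ k → ‖1 - C h‖ ≤ 2 / 2 ^ k := by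
    intro k
    induction k with
    | zero => intro h hh; simpa using (hlt h (by simpa using hh)).le
    | succ k ih =>
      intro h hh
      have h1 := hscale hh
      have h2 := hhalf h (h1.trans (hle k))
      have h3 := ih _ h1
      rw [pow_succ, ← div_div]
      linarith
  have hM0 : 0 ≤ M := (norm_nonneg _).trans (hM 0)
  have hdiff : ∀ (t : ℝ) (k : ℕ) (h : ℝ), |h| ≤ ε / 2 ^ k →
      ‖C (t + h) - C t‖ ≤ 2 * M * ((k + 1) / 2 ^ k) := by
    intro t k
    induction k with
    | zero =>
      intro h _
      norm_num
      linarith [norm_sub_le (C (t + h)) (C t), hM (t + h), hM t]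
    | succ k ih =>
      intro h hh
      have h1 := ih _ (hscale hh)
      have h2 := hone _ _ hh
      have h3 := hC (t + h) h
      rw [add_sub_cancel_right, add_assoc, ← two_mul] at h3
      have h4 : (2 : ℂ) • (C (t + h) - C t)
          = C (t + 2 * h) - C t + (2 : ℂ) • (C (t + h) * (1 - C h)) := by
        rw [eq_sub_of_add_eq h3, two_smul, two_smul]
        noncomm_ring
      have h5 : ‖C (t + h) * (1 - C h)‖ ≤ M * (2 / 2 ^ (k + 1)) :=
        (norm_mul_le _ _).trans (mul_le_mul (hM _) h2 (norm_nonneg _) hM0)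
      have h6 := norm_add_le (C (t + 2 * h) - C t) ((2 : ℂ) • (C (t + h) * (1 - C h)))
      rw [← h4, norm_smul, norm_smul, Complex.norm_ofNat] at h6
      have h7 : 2 * M * (((k + 1 : ℕ) + 1) / 2 ^ (k + 1))
          = (2 * M * ((k + 1) / 2 ^ k) + 2 * (M * (2 / 2 ^ (k + 1)))) / 2 := by
        rw [pow_succ]; push_cast; field_simp
      rw [h7]
      linarith
  have hlim : Tendsto (fun k : ℕ ↦ 2 * M * (((k : ℝ) + 1) / 2 ^ k)) atTop (𝓝 0) := by
    have h1 := tendsto_pow_const_div_const_pow_of_one_lt 1 (one_lt_two (α := ℝ))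
    have h2 := tendsto_pow_const_div_const_pow_of_one_lt 0 (one_lt_two (α := ℝ))
    simpa [add_div] using (h1.add h2).const_mul (2 * M)
  rw [Metric.continuous_iff]
  intro t e he
  obtain ⟨k, hk⟩ := (hlim.eventually_lt_const he).exists
  refine ⟨ε / 2 ^ k, by positivity, fun s hs ↦ ?_⟩
  rw [dist_eq_norm]
  have h1 := hdiff t k (s - t) hs.le
  rw [add_sub_cancel] at h1
  exact h1.trans_lt hk

end CosineFunction

theorem stmt_18 {A : Type*} [NormedRing A] [NormedAlgebra ℂ A] [CompleteSpace A]
    (C : ℝ → A) (hC0 : C 0 = 1)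
    (hC : ∀ s t : ℝ, C (s + t) + C (s - t) = 2 * C s * C t)
    (a : ℝ) (m : ℝ) (hm : m < 8 / (3 * Real.sqrt 3))
    (hbd : ∀ t : ℝ, ‖C t - algebraMap ℂ A ((Real.cos (a * t) : ℝ))‖ ≤ m) :
    ∀ t : ℝ, C t = algebraMap ℂ A ((Real.cos (a * t) : ℝ)) := by
  have hm2 : m < 2 := (hm.trans eight_div_lt).trans (by norm_num)
  have hσ : ∀ t : ℝ, ∀ l ∈ spectrum ℂ (C t), l = (Real.cos (a * t) : ℝ) :=
    fun t l hl ↦ eq_cos_of_mem_spectrum hC0 hC hm hbd hl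
  have hnorm_algebraMap : ∀ x : ℝ, ‖algebraMap ℂ A (x : ℝ)‖ = |x| * ‖(1 : A)‖ := fun x ↦ by
    rw [norm_algebraMap, Complex.norm_real, Real.norm_eq_abs]
  have hM : ∀ t, ‖C t‖ ≤ m + ‖(1 : A)‖ := fun t ↦ by
    have h1 := norm_sub_norm_le (C t) (algebraMap ℂ A (Real.cos (a * t) : ℝ))
    have h2 := mul_le_of_le_one_left (norm_nonneg (1 : A)) (Real.abs_cos_le_one (a * t))
    rw [hnorm_algebraMap] at h1
    linarith [hbd t]
  rcases eq_or_ne a 0 with rfl | ha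
  · intro t
    rw [eq_one_of_cos_eq_one hC0 hC hm2 hbd hσ (by simp)]
    simp
  have hcont : Continuous C := by
    have h1 : ∀ᶠ t in 𝓝 (0 : ℝ), 0 < Real.cos (a * t) :=
      ContinuousAt.eventually_lt continuousAt_const (by fun_prop) (by simp)
    have h2 : ∀ᶠ t in 𝓝 (0 : ℝ), m + |Real.cos (a * t) - 1| * ‖(1 : A)‖ < 2 :=
      ContinuousAt.eventually_lt (by fun_prop) continuousAt_const (by simpa using hm2)
    obtain ⟨ε, hε, hball⟩ := Metric.eventually_nhds_iff_ball.1 (h1.and h2)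
    have hmem : ∀ t, |t| ≤ ε / 2 → t ∈ Metric.ball (0 : ℝ) ε := fun t ht ↦ by
      rw [mem_ball_zero_iff, Real.norm_eq_abs]; linarith
    have hlt : ∀ t, |t| ≤ ε / 2 → ‖1 - C t‖ < 2 := fun t ht ↦ by
      have h3 := norm_add_le (C t - algebraMap ℂ A (Real.cos (a * t) : ℝ))
        (algebraMap ℂ A ((Real.cos (a * t) - 1 : ℝ) : ℂ))
      rw [hnorm_algebraMap, Complex.ofReal_sub, Complex.ofReal_one, map_sub, map_one,
        sub_add_sub_cancel] at h3
      rw [norm_sub_rev]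
      linarith [hbd t, (hball t (hmem t ht)).2]
    refine continuous_of_norm_one_sub_le_half hC hM (half_pos hε) hlt fun t ht ↦ ?_
    refine norm_one_sub_le_half hC0 hC hσ (hball t (hmem t ?_)).1 (hlt _ ht)
    rw [abs_mul, abs_two] at ht
    linarith [abs_nonneg t]
  set p := 2 * Real.pi / a with hp
  have hdyadic : ∀ j : ℕ, C (p / 2 ^ j) = algebraMap ℂ A (Real.cos (a * (p / 2 ^ j)) : ℝ) := by
    intro j
    induction j with
    | zero =>
      have h1 : Real.cos (a * p) = 1 := by rw [hp, mul_div_cancel₀ _ ha, Real.cos_two_pi]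
      rw [pow_zero, div_one, eq_one_of_cos_eq_one hC0 hC hm2 hbd hσ h1, h1]
      simp
    | succ j ih =>
      apply eq_cos_half hC0 hC hM hσ
      rwa [show 2 * (p / 2 ^ (j + 1)) = p / 2 ^ j by rw [pow_succ]; field_simp]
  have hmul : ∀ n j : ℕ, C (n * (p / 2 ^ j))
      = algebraMap ℂ A (Real.cos (a * (n * (p / 2 ^ j))) : ℝ) := by
    intro n j
    rw [cosineFunction_nat_mul hC0 hC, hdyadic, Polynomial.aeval_algebraMap_apply_eq_algebraMap_eval,
      Complex.ofReal_cos, Polynomial.Chebyshev.T_complex_cos, Complex.ofReal_cos]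
    congr 2
    push_cast
    ring
  have hp0 : p ≠ 0 := div_ne_zero (by positivity) ha
  have hnonneg : ∀ x : ℝ, 0 ≤ x → C (x * p) = algebraMap ℂ A (Real.cos (a * (x * p)) : ℝ) := by
    intro x hx
    have hx' : Tendsto (fun j : ℕ ↦ (⌊x * 2 ^ j⌋₊ : ℝ) / 2 ^ j) atTop (𝓝 x) :=
      (tendsto_nat_floor_mul_div_atTop hx).comp
        (tendsto_pow_atTop_atTop_of_one_lt (one_lt_two (α := ℝ)))
    have hc : Continuous fun x : ℝ ↦ algebraMap ℂ A (Real.cos (a * (x * p)) : ℝ) :=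
      (continuous_algebraMap ℂ A).comp (by fun_prop)
    have hc' : Continuous fun x : ℝ ↦ C (x * p) := by fun_prop
    refine tendsto_nhds_unique ((hc'.tendsto x).comp hx') (((hc.tendsto x).comp hx').congr ?_)
    intro j
    have := hmul ⌊x * 2 ^ j⌋₊ j
    rw [← mul_div_assoc, ← div_mul_eq_mul_div] at this
    exact this.symm
  intro t
  have ht : t = t / p * p := by field_simp
  rcases le_total 0 (t / p) with h0 | h0
  · rw [ht]; exact hnonneg _ h0
  · have h1 := hnonneg (-(t / p)) (neg_nonneg.2 h0)
    rwa [neg_mul, ← ht, mul_neg, Real.cos_neg, cosineFunction_neg hC0 hC] at h1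
end
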